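/- Let n be a positive integer and regard the space M_n(ℂ) of n×n complex matrices as a finite-dimensional real vector space. Let T : 𝓢(M_n(ℂ), ℂ) → ℂ be a tempered distribution such that for every g ∈ GL_n(ℂ) and every Schwartz function φ one has T(x ↦ φ(g x g⁻¹)) = T(φ). Then T(x ↦ φ(xᵀ)) = T(φ) for every Schwartz function φ, where xᵀ is the (non-conjugated) transpose. -/

import Mathlib

/-!
Tempered-distribution form, over `k = ℂ`, of part (a) of Theorem D:
a `GLₙ(ℂ)`-conjugation-invariant tempered distribution on `Mₙ(ℂ)`
(viewed as a finite-dimensional real vector space) is transpose-invariant.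
-/

section

open SchwartzMap
open scoped LineDeriv

namespace SchwartzMap

theorem exists_forall_norm_le_of_seminorm_le {E W : Type*} [NormedAddCommGroup E] [NormedSpace ℝ E]
    [NormedAddCommGroup W] [NormedSpace ℝ W] [NormedSpace ℂ W] [SMulCommClass ℝ ℂ W]
    (T : 𝓢(E, W) →L[ℂ] ℂ) :
    ∃ (N : ℕ) (C : ℝ), 0 ≤ C ∧ ∀ (f : 𝓢(E, W)) (M : ℝ), 0 ≤ M →
      (∀ k ≤ N, ∀ l ≤ N, ∀ x, ‖x‖ ^ k * ‖iteratedFDeriv ℝ l f x‖ ≤ M) → ‖T f‖ ≤ C * M := by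
  obtain ⟨s, C, hC⟩ := Seminorm.bound_of_continuous (schwartz_withSeminorms ℂ E W)
    ((normSeminorm ℂ ℂ).comp T.toLinearMap) (by
      exact continuous_norm.comp T.continuous)
  refine ⟨s.sup (fun p => max p.1 p.2), C, C.2, fun f M hM h => ?_⟩
  refine (hC.2 f).trans ?_
  rw [_root_.smul_apply]
  refine mul_le_mul_of_nonneg_left ?_ C.2
  refine Seminorm.finset_sup_apply_le hM fun p hp => ?_
  have hp' : max p.1 p.2 ≤ s.sup (fun p => max p.1 p.2) :=
    Finset.le_sup (f := fun p : ℕ × ℕ => max p.1 p.2) hp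
  exact seminorm_le_bound ℂ _ _ f hM
    (h p.1 ((le_max_left _ _).trans hp') p.2 ((le_max_right _ _).trans hp'))

universe u

variable {E W : Type u} [NormedAddCommGroup E] [NormedSpace ℝ E]
  [NormedAddCommGroup W] [NormedSpace ℝ W]

/-- The first-order Taylor remainder of a Schwartz function along `v`. -/
noncomputable def translationRemainder (v : E) (s : ℝ) (f : 𝓢(E, W)) : 𝓢(E, W) :=
  compSubConstCLM ℝ (-(s • v)) f - f - s • ∂_{v} f

theorem translationRemainder_apply (v : E) (s : ℝ) (f : 𝓢(E, W)) (x : E) :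
    translationRemainder v s f x = f (x + s • v) - f x - s • fderiv ℝ f x v := by
  simp [translationRemainder, lineDerivOp_apply_eq_fderiv]

theorem fderivCLM_translationRemainder (v : E) (s : ℝ) (f : 𝓢(E, W)) :
    fderivCLM ℝ E W (translationRemainder v s f) =
      translationRemainder v s (fderivCLM ℝ E W f) := by
  ext x w
  have h : (translationRemainder v s f : E → W) =
      fun x => f (x + s • v) - f x - s • fderiv ℝ f x v :=
    funext (translationRemainder_apply v s f)
  have hd : HasFDerivAt (fderiv ℝ f) (fderiv ℝ (fderiv ℝ f) x) x :=
    (fderivCLM ℝ E W f).hasFDerivAt x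
  have h1 : HasFDerivAt (fun x => f (x + s • v)) (fderiv ℝ f (x + s • v)) x := by
    exact (hasFDerivAt_comp_add_right (s • v)).2 (f.hasFDerivAt (x + s • v))
  have h2 := ((h1.sub (f.hasFDerivAt x)).sub ((hd.clm_apply (hasFDerivAt_const v x)).const_smul s))
  have hs : IsSymmSndFDerivAt ℝ f x := (f.contDiffAt 2).isSymmSndFDerivAt (by simp)
  rw [fderivCLM_apply, h]
  have h3 := h2.fderiv
  have h4 : (fderiv ℝ (fun x => f (x + s • v) - f x - s • fderiv ℝ f x v) x) w = _ :=
    congrArg (fun L => L w) h3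
  rw [h4, translationRemainder_apply]
  simp only [fderivCLM_apply]
  have : (fderiv ℝ (⇑((fderivCLM ℝ E W) f)) x) = fderiv ℝ (fderiv ℝ f) x := rfl
  simp [this, hs.eq v w]

theorem exists_norm_translationRemainder_le (v : E) (f : 𝓢(E, W)) (k : ℕ) :
    ∃ C, ∀ s : ℝ, |s| ≤ 1 → ∀ x, ‖x‖ ^ k * ‖translationRemainder v s f x‖ ≤ C * s ^ 2 := by
  set D := fderivCLM ℝ E (E →L[ℝ] W) (fderivCLM ℝ E W f) with hD
  set M := 2 ^ k * (SchwartzMap.seminorm ℝ k 0 D + ‖v‖ ^ k * SchwartzMap.seminorm ℝ 0 0 D)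
  have hM : ∀ x, ∀ r : ℝ, |r| ≤ 1 → ‖x‖ ^ k * ‖D (x + r • v)‖ ≤ M := by
    intro x r hr
    have h1 : ‖x‖ ≤ ‖x + r • v‖ + ‖v‖ := by
      calc ‖x‖ = ‖(x + r • v) - r • v‖ := by simp
        _ ≤ ‖x + r • v‖ + ‖r • v‖ := norm_sub_le _ _
        _ ≤ _ := by
          rw [norm_smul]; gcongr
          exact mul_le_of_le_one_left (norm_nonneg _) hr
    have h2 : ‖x‖ ^ k ≤ 2 ^ k * (‖x + r • v‖ ^ k + ‖v‖ ^ k) := by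
      refine (pow_le_pow_left₀ (norm_nonneg _) h1 k).trans ?_
      refine (add_pow_le (norm_nonneg _) (norm_nonneg _) k).trans ?_
      gcongr
      · norm_num
      · omega
    have h3 := norm_pow_mul_le_seminorm ℝ D k (x + r • v)
    have h4 := norm_le_seminorm ℝ D (x + r • v)
    calc ‖x‖ ^ k * ‖D (x + r • v)‖ ≤ 2 ^ k * (‖x + r • v‖ ^ k + ‖v‖ ^ k) * ‖D (x + r • v)‖ := by
          gcongr
      _ = 2 ^ k * (‖x + r • v‖ ^ k * ‖D (x + r • v)‖ + ‖v‖ ^ k * ‖D (x + r • v)‖) := by ring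
      _ ≤ 2 ^ k * (SchwartzMap.seminorm ℝ k 0 D + ‖v‖ ^ k * SchwartzMap.seminorm ℝ 0 0 D) := by
          gcongr
  refine ⟨M * ‖v‖ * ‖v‖, fun s hs x => ?_⟩
  rw [translationRemainder_apply]
  have hd1 : ∀ r : ℝ, HasDerivAt (fun r : ℝ => fderiv ℝ f (x + r • v) v) (D (x + r • v) v v) r := by
    intro r
    have h0 : HasDerivAt (fun r : ℝ => x + r • v) v r := by
      simpa using ((hasDerivAt_id r).smul_const v).const_add x
    have h1 := ((fderivCLM ℝ E W f).hasFDerivAt (x + r • v)).comp_hasDerivAt r h0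
    exact (ContinuousLinearMap.apply ℝ W v).hasFDerivAt.comp_hasDerivAt r h1
  have hd0 : ∀ r : ℝ, HasDerivAt (fun r : ℝ => f (x + r • v)) (fderiv ℝ f (x + r • v) v) r := by
    intro r
    have h0 : HasDerivAt (fun r : ℝ => x + r • v) v r := by
      simpa using ((hasDerivAt_id r).smul_const v).const_add x
    exact (f.hasFDerivAt (x + r • v)).comp_hasDerivAt r h0
  have hset : ∀ r ∈ Set.uIcc 0 s, |r| ≤ |s| := by
    intro r hr
    have := Set.abs_sub_left_of_mem_uIcc hr
    simpa using this
  have key1 : ∀ r ∈ Set.uIcc 0 s, ‖x‖ ^ k * ‖fderiv ℝ f (x + r • v) v - fderiv ℝ f x v‖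
      ≤ M * ‖v‖ * ‖v‖ * |s| := by
    intro r hr
    have := (convex_uIcc (0:ℝ) s).norm_image_sub_le_of_norm_hasDerivWithin_le
      (f := fun r : ℝ => ‖x‖ ^ k • fderiv ℝ f (x + r • v) v)
      (f' := fun r => ‖x‖ ^ k • D (x + r • v) v v) (C := M * ‖v‖ * ‖v‖) (x := 0) (y := r)
      (fun r _ => ((hd1 r).const_smul _).hasDerivWithinAt) (fun r hr => by
        rw [norm_smul, norm_pow, norm_norm]
        calc _ ≤ ‖x‖ ^ k * (‖D (x + r • v)‖ * ‖v‖ * ‖v‖) := by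
              gcongr; exact ContinuousLinearMap.le_opNorm₂ _ _ _
          _ = (‖x‖ ^ k * ‖D (x + r • v)‖) * ‖v‖ * ‖v‖ := by ring
          _ ≤ _ := by gcongr; exact hM x r ((hset r hr).trans hs)) Set.left_mem_uIcc hr
    rw [← smul_sub, norm_smul, norm_pow, norm_norm] at this
    simp only [zero_smul, add_zero, sub_zero, Real.norm_eq_abs] at this
    refine this.trans ?_
    have := hset r hr
    have hM0 : 0 ≤ M := (by positivity : 0 ≤ ‖x‖ ^ k * ‖D (x + (0:ℝ) • v)‖).trans (hM x 0 (by simp))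
    gcongr
  have := (convex_uIcc (0:ℝ) s).norm_image_sub_le_of_norm_hasDerivWithin_le
      (f := fun r : ℝ => ‖x‖ ^ k • (f (x + r • v) - r • fderiv ℝ f x v))
      (f' := fun r => ‖x‖ ^ k • (fderiv ℝ f (x + r • v) v - fderiv ℝ f x v))
      (C := M * ‖v‖ * ‖v‖ * |s|) (x := 0) (y := s)
      (fun r _ => (((hd0 r).sub (by
        simpa using (hasDerivAt_id r).smul_const (fderiv ℝ f x v))).const_smul _).hasDerivWithinAt)
      (fun r hr => by
        rw [norm_smul, norm_pow, norm_norm]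
        exact key1 r hr) Set.left_mem_uIcc Set.right_mem_uIcc
  rw [← smul_sub, norm_smul, norm_pow, norm_norm] at this
  have e : f (x + s • v) - s • fderiv ℝ f x v - (f (x + (0:ℝ) • v) - (0:ℝ) • fderiv ℝ f x v) =
    f (x + s • v) - f x - s • fderiv ℝ f x v := by simp; abel
  rw [e] at this
  refine this.trans (le_of_eq ?_)
  rw [sub_zero, Real.norm_eq_abs, mul_assoc, abs_mul_abs_self]; ring

theorem exists_norm_iteratedFDeriv_translationRemainder_le (v : E) (l : ℕ) : ∀ {W : Type u}
    [NormedAddCommGroup W] [NormedSpace ℝ W] (f : 𝓢(E, W)) (k : ℕ),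
    ∃ C, ∀ s : ℝ, |s| ≤ 1 → ∀ x,
      ‖x‖ ^ k * ‖iteratedFDeriv ℝ l (translationRemainder v s f) x‖ ≤ C * s ^ 2 := by
  induction l with
  | zero =>
    intro W _ _ f k
    simpa using exists_norm_translationRemainder_le v f k
  | succ l ih =>
    intro W _ _ f k
    obtain ⟨C, hC⟩ := ih (fderivCLM ℝ E W f) k
    refine ⟨C, fun s hs x => ?_⟩
    have := hC s hs x
    rw [← fderivCLM_translationRemainder] at this
    rw [← norm_iteratedFDeriv_fderiv]
    exact this

theorem hasDerivAt_comp_translation {E : Type} [NormedAddCommGroup E] [NormedSpace ℝ E]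
    (T : 𝓢(E, ℂ) →L[ℂ] ℂ) (v : E) (f : 𝓢(E, ℂ)) :
    HasDerivAt (fun s : ℝ => T (compSubConstCLM ℝ (-(s • v)) f)) (T (∂_{v} f)) 0 := by
  obtain ⟨N, C, hC0, hC⟩ := exists_forall_norm_le_of_seminorm_le T
  choose c hc using fun l k => exists_norm_iteratedFDeriv_translationRemainder_le v l f k
  set M := ∑ k ∈ Finset.range (N + 1), ∑ l ∈ Finset.range (N + 1), |c l k|
  have hM : ∀ s : ℝ, |s| ≤ 1 → ‖T (translationRemainder v s f)‖ ≤ C * (M * s ^ 2) := by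
    intro s hs
    refine hC _ _ (by positivity) fun k hk l hl x => (hc l k s hs x).trans ?_
    gcongr
    refine (le_abs_self _).trans ?_
    refine (Finset.single_le_sum (f := fun l => |c l k|) (fun _ _ => abs_nonneg _)
      (Finset.mem_range.2 (Nat.lt_succ_of_le hl))).trans ?_
    exact Finset.single_le_sum (f := fun k => ∑ l ∈ Finset.range (N + 1), |c l k|)
      (fun _ _ => Finset.sum_nonneg fun _ _ => abs_nonneg _)
      (Finset.mem_range.2 (Nat.lt_succ_of_le hk))
  rw [hasDerivAt_iff_isLittleO]
  refine Asymptotics.IsBigO.trans_isLittleO (g := fun s : ℝ => s ^ 2) ?_ ?_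
  · refine Asymptotics.IsBigO.of_bound (C * M) ?_
    filter_upwards [Metric.ball_mem_nhds (0:ℝ) one_pos] with s hs
    have hs' : |s| ≤ 1 := by simpa using (Metric.mem_ball.1 hs).le
    have := hM s hs'
    have e : T (translationRemainder v s f) = T (compSubConstCLM ℝ (-(s • v)) f) - T f -
        s • T (∂_{v} f) := by
      have : s • ∂_{v} f = (s : ℂ) • ∂_{v} f := by ext x; simp
      rw [translationRemainder, map_sub, map_sub, this, map_smul]
      simp
    rw [e] at this
    simp only [sub_zero, zero_smul, neg_zero, compSubConstCLM_zero, ContinuousLinearMap.id_apply]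
    refine this.trans (le_of_eq ?_)
    rw [Real.norm_eq_abs, abs_of_nonneg (sq_nonneg s)]; ring
  · simpa using Asymptotics.isLittleO_pow_pow (𝕜 := ℝ) (m := 1) (n := 2) (by norm_num)

end SchwartzMap

end

section

open SchwartzMap
open scoped ContDiff

namespace SchwartzMap

theorem exists_one_add_pow_mul_exp_le (m : ℕ) (a : ℝ) {c : ℝ} (hc : 0 < c) :
    ∃ M, 0 ≤ M ∧ ∀ r : ℝ, 0 ≤ r → (1 + r) ^ m * Real.exp (a * r - c * r ^ 2) ≤ M := by
  refine ⟨m.factorial * Real.exp (1 + (a + 1) ^ 2 / (4 * c)), by positivity, fun r hr => ?_⟩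
  have h1 := Real.pow_div_factorial_le_exp (1 + r) (by positivity) m
  rw [div_le_iff₀ (by positivity)] at h1
  calc (1 + r) ^ m * Real.exp (a * r - c * r ^ 2)
      ≤ (Real.exp (1 + r) * m.factorial) * Real.exp (a * r - c * r ^ 2) := by gcongr
    _ = m.factorial * Real.exp ((1 + r) + (a * r - c * r ^ 2)) := by rw [Real.exp_add (1 + r)]; ring
    _ ≤ _ := by
      refine mul_le_mul_of_nonneg_left (Real.exp_le_exp.2 ?_) (by positivity)
      have : (a + 1) ^ 2 / (4 * c) - ((a + 1) * r - c * r ^ 2) =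
          (a + 1 - 2 * c * r) ^ 2 / (4 * c) := by
        field_simp; ring
      have h2 : 0 ≤ (a + 1 - 2 * c * r) ^ 2 / (4 * c) := by positivity
      linarith

variable {E : Type*} [NormedAddCommGroup E] [NormedSpace ℝ E]

theorem contDiff_cexp_neg {u : E → ℝ} (hu : ContDiff ℝ ∞ u) :
    ContDiff ℝ ∞ fun x => Complex.exp (-(u x : ℂ)) :=
  (Complex.ofRealCLM.contDiff.comp hu).neg.cexp

theorem exists_norm_iteratedFDeriv_cexp_neg_le {u : E → ℝ} (hu : u.HasTemperateGrowth) (n : ℕ) :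
    ∃ (k : ℕ) (C : ℝ), 0 ≤ C ∧ ∀ x,
      ‖iteratedFDeriv ℝ n (fun x => Complex.exp (-(u x : ℂ))) x‖ ≤
        C * (1 + ‖x‖) ^ k * Real.exp (-u x) := by
  obtain ⟨k, C, hC, h⟩ := hu.neg.norm_iteratedFDeriv_le_uniform n
  refine ⟨k * n, n.factorial * (max C 1) ^ n, by positivity, fun x => ?_⟩
  have e : (fun x => Complex.exp (-(u x : ℂ))) =
      Complex.ofRealLI ∘ (Real.exp ∘ fun x => -u x) := by
    ext x; simp
  rw [e, LinearIsometry.norm_iteratedFDeriv_comp_left (n := ∞) _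
    (Real.contDiff_exp.comp hu.1.neg).contDiffAt (by exact_mod_cast le_top)]
  refine (norm_iteratedFDeriv_comp_le (N := ∞) Real.contDiff_exp hu.1.neg
    (by exact_mod_cast le_top) x (C := Real.exp (-u x))
      (D := max C 1 * (1 + ‖x‖) ^ k) ?_ ?_).trans_eq ?_
  · intro i _
    rw [norm_iteratedFDeriv_eq_norm_iteratedDeriv, iteratedDeriv_eq_iterate, Real.iter_deriv_exp]
    simp
  · intro i hi hin
    have h1 : 1 ≤ max C 1 * (1 + ‖x‖) ^ k :=
      one_le_mul_of_one_le_of_one_le (le_max_right _ _) (one_le_pow₀ (by linarith [norm_nonneg x]))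
    refine (h i hin x).trans (le_trans ?_ (le_self_pow₀ h1 (by omega)))
    gcongr; exact le_max_left _ _
  · rw [mul_pow, pow_mul]; ring

/-- The Schwartz function `exp (-u)` for a coercive function `u` of temperate growth. -/
noncomputable def cexpNeg (u : E → ℝ) (hu : u.HasTemperateGrowth) {c : ℝ} (hc : 0 < c)
    (huc : ∀ x, c * ‖x‖ ^ 2 ≤ u x) : 𝓢(E, ℂ) where
  toFun x := Complex.exp (-(u x : ℂ))
  smooth' := contDiff_cexp_neg hu.1
  decay' k n := by
    obtain ⟨m, C, hC, h⟩ := exists_norm_iteratedFDeriv_cexp_neg_le hu n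
    obtain ⟨M, hM, hb⟩ := exists_one_add_pow_mul_exp_le (k + m) 0 hc
    refine ⟨C * M, fun x => ?_⟩
    calc _ ≤ (1 + ‖x‖) ^ k * (C * (1 + ‖x‖) ^ m * Real.exp (-u x)) := by
          gcongr
          · linarith
          · exact h x
      _ = C * ((1 + ‖x‖) ^ (k + m) * Real.exp (-u x)) := by rw [pow_add]; ring
      _ ≤ C * ((1 + ‖x‖) ^ (k + m) * Real.exp (0 * ‖x‖ - c * ‖x‖ ^ 2)) := by
          gcongr; linarith [huc x]
      _ ≤ C * M := by gcongr; exact hb _ (norm_nonneg _)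

@[simp]
theorem cexpNeg_apply (u : E → ℝ) (hu : u.HasTemperateGrowth) {c : ℝ} (hc : 0 < c)
    (huc : ∀ x, c * ‖x‖ ^ 2 ≤ u x) (x : E) :
    cexpNeg u hu hc huc x = Complex.exp (-(u x : ℂ)) := rfl

variable [FiniteDimensional ℝ E]

theorem eq_zero_of_forall_hasCompactSupport {T : 𝓢(E, ℂ) →L[ℂ] ℂ}
    (h : ∀ φ : 𝓢(E, ℂ), HasCompactSupport φ → T φ = 0) : T = 0 := by
  ext φ
  obtain ⟨N, C, hC, hb⟩ := exists_forall_norm_le_of_seminorm_le T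
  let χ : ContDiffBump (0 : E) := ⟨1, 2, one_pos, one_lt_two⟩
  have hχ : ContDiff ℝ ∞ (χ : E → ℝ) := χ.contDiff
  let η : E → ℂ := fun x => 1 - (χ x : ℂ)
  have hη : ContDiff ℝ ∞ η := contDiff_const.sub (Complex.ofRealCLM.contDiff.comp hχ)
  have hηb : ∀ i, ∃ B, 0 ≤ B ∧ ∀ x, ‖iteratedFDeriv ℝ i η x‖ ≤ B := by
    intro i
    have hcsχ : HasCompactSupport fun x => (χ x : ℂ) :=
      χ.hasCompactSupport.comp_left (g := fun t : ℝ => (t : ℂ)) Complex.ofReal_zero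
    have hχc : ContDiff ℝ ∞ fun x => (χ x : ℂ) := Complex.ofRealCLM.contDiff.comp hχ
    obtain ⟨B, hB⟩ := (hχc.continuous_iteratedFDeriv
      (m := i) (by exact_mod_cast le_top)).bounded_above_of_compact_support
        (hcsχ.iteratedFDeriv i)
    have hc : ∀ x, ‖iteratedFDeriv ℝ i (fun _ : E => (1 : ℂ)) x‖ ≤ 1 := by
      intro x
      rcases i with _ | i
      · simp
      · simp [iteratedFDeriv_const_of_ne (Nat.succ_ne_zero i)]
    refine ⟨1 + max B 0, by positivity, fun x => ?_⟩
    have : η = (fun _ : E => (1 : ℂ)) - fun x => (χ x : ℂ) := rfl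
    rw [this, iteratedFDeriv_sub_apply contDiff_const.contDiffAt
      (hχc.of_le (by exact_mod_cast le_top)).contDiffAt]
    exact (norm_sub_le _ _).trans (add_le_add (hc x) ((hB x).trans (le_max_left _ _)))
  have hη0 : ∀ i x, ‖x‖ < 1 → iteratedFDeriv ℝ i η x = 0 := by
    intro i x hx
    have : η =ᶠ[nhds x] fun _ => 0 := by
      filter_upwards [(isOpen_lt continuous_norm continuous_const).mem_nhds hx] with y hy
      have : χ y = 1 := χ.one_of_mem_closedBall (by simpa using le_of_lt hy)
      simp [η, this]
    rw [(Filter.EventuallyEq.iteratedFDeriv ℝ this i).eq_of_nhds]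
    exact congrFun iteratedFDeriv_fun_zero x
  choose B hB0 hB using hηb
  let S : ℝ := ∑ k ∈ Finset.range (N + 1), ∑ l ∈ Finset.range (N + 1),
    ∑ i ∈ Finset.range (l + 1), l.choose i * B i * SchwartzMap.seminorm ℝ (k + 1) (l - i) φ
  have hmain : ∀ n : ℕ, 0 < n → ‖T φ‖ ≤ C * (S * (1 / (n : ℝ))) := by
    intro n hn
    have hn' : (1 : ℝ) ≤ n := by exact_mod_cast hn
    have hn0 : (0 : ℝ) < n := by linarith
    have hcs : HasCompactSupport fun x => (χ ((n : ℝ)⁻¹ • x) : ℂ) * φ x := by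
      have h1 : HasCompactSupport fun x => (χ ((n : ℝ)⁻¹ • x) : ℂ) :=
        (χ.hasCompactSupport.comp_smul (inv_ne_zero hn0.ne')).comp_left
          (g := fun t : ℝ => (t : ℂ)) Complex.ofReal_zero
      exact h1.mul_right
    have hcd : ContDiff ℝ ∞ fun x => (χ ((n : ℝ)⁻¹ • x) : ℂ) * φ x :=
      (Complex.ofRealCLM.contDiff.comp (hχ.comp (contDiff_const_smul _))).mul (φ.smooth ⊤)
    set ψ := hcs.toSchwartzMap hcd with hψ
    have e : T φ = T (φ - ψ) := by rw [map_sub, h ψ hcs, sub_zero]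
    have e2 : ((φ - ψ : 𝓢(E, ℂ)) : E → ℂ) = fun x => η ((n : ℝ)⁻¹ • x) * φ x := by
      ext x
      have : ψ x = (χ ((n : ℝ)⁻¹ • x) : ℂ) * φ x := rfl
      simp [η, this]; ring
    rw [e]
    refine hb _ _ ?_ fun k hk l hl x => ?_
    · have : 0 ≤ S := Finset.sum_nonneg fun _ _ => Finset.sum_nonneg fun _ _ =>
        Finset.sum_nonneg fun i _ => by have := hB0 i; positivity
      positivity
    rw [e2]
    have hl1 : (l : ℕ∞ω) ≤ (∞ : ℕ∞ω) := by exact_mod_cast le_top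
    refine (mul_le_mul_of_nonneg_left (norm_iteratedFDeriv_mul_le (N := ∞)
      (hη.comp (contDiff_const_smul _)) (φ.smooth ⊤) x hl1) (by positivity)).trans ?_
    have hSl : ∑ i ∈ Finset.range (l + 1), l.choose i * B i *
        SchwartzMap.seminorm ℝ (k + 1) (l - i) φ ≤ S := by
      have h0 : ∀ k l, 0 ≤ ∑ i ∈ Finset.range (l + 1), l.choose i * B i *
          SchwartzMap.seminorm ℝ (k + 1) (l - i) φ := fun k l =>
        Finset.sum_nonneg fun i _ => by have := hB0 i; positivity
      refine (Finset.single_le_sum (f := fun l => ∑ i ∈ Finset.range (l + 1), l.choose i * B i *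
        SchwartzMap.seminorm ℝ (k + 1) (l - i) φ) (fun l _ => h0 k l)
        (Finset.mem_range.2 (Nat.lt_succ_of_le hl))).trans ?_
      exact Finset.single_le_sum (f := fun k => ∑ l ∈ Finset.range (N + 1),
        ∑ i ∈ Finset.range (l + 1), l.choose i * B i * SchwartzMap.seminorm ℝ (k + 1) (l - i) φ)
        (fun k _ => Finset.sum_nonneg fun l _ => h0 k l)
        (Finset.mem_range.2 (Nat.lt_succ_of_le hk))
    refine le_trans ?_ (mul_le_mul_of_nonneg_right hSl (by positivity))
    rw [Finset.mul_sum, Finset.sum_mul]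
    refine Finset.sum_le_sum fun i hi => ?_
    have hcomp : η ∘ (fun p => (n : ℝ)⁻¹ • p) = fun z => η ((n : ℝ)⁻¹ • z) := rfl
    rw [hcomp, iteratedFDeriv_comp_const_smul _ (hη.of_le (by exact_mod_cast le_top))]
    rcases lt_or_ge ‖(n : ℝ)⁻¹ • x‖ 1 with h1 | h1
    · simp only [hη0 i _ h1, smul_zero, norm_zero, mul_zero, zero_mul]
      have := hB0 i
      positivity
    · rw [norm_smul, norm_inv, Real.norm_of_nonneg hn0.le, inv_mul_eq_div, one_le_div hn0] at h1
      have h2 : ‖(n : ℝ)⁻¹ ^ i • iteratedFDeriv ℝ i η ((n : ℝ)⁻¹ • x)‖ ≤ B i := by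
        rw [norm_smul, norm_pow, norm_inv, Real.norm_of_nonneg hn0.le]
        have : (n : ℝ)⁻¹ ^ i ≤ 1 := pow_le_one₀ (by positivity) (inv_le_one_of_one_le₀ hn')
        exact (mul_le_of_le_one_left (norm_nonneg _) this).trans (hB i _)
      have h3 := le_seminorm ℝ (k + 1) (l - i) φ x
      have h4 : ‖x‖ ^ k ≤ ‖x‖ ^ (k + 1) * (1 / n) := by
        rw [pow_succ, mul_assoc]
        refine le_mul_of_one_le_right (by positivity) ?_
        rw [mul_one_div, one_le_div hn0]; exact h1
      calc _ ≤ (‖x‖ ^ (k + 1) * (1 / n)) * (l.choose i * B i * ‖iteratedFDeriv ℝ (l - i) φ x‖) := by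
            gcongr
        _ = l.choose i * B i * (‖x‖ ^ (k + 1) * ‖iteratedFDeriv ℝ (l - i) φ x‖) * (1 / n) := by ring
        _ ≤ _ := by
          have := hB0 i
          gcongr
  have hlim : Filter.Tendsto (fun n : ℕ => C * (S * (1 / (n : ℝ)))) Filter.atTop (nhds 0) := by
    simpa using (tendsto_one_div_atTop_nhds_zero_nat (𝕜 := ℝ)).const_mul S |>.const_mul C
  have := ge_of_tendsto hlim (Filter.eventually_atTop.2 ⟨1, fun n hn => hmain n hn⟩)
  simpa using this

end SchwartzMap

end

section

open scoped ContDiff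
open MeasureTheory

/-- The remainder of the exponential series after `m` terms. -/
noncomputable def expRemainder (m : ℕ) (z : ℂ) : ℂ :=
  Complex.exp z - ∑ j ∈ Finset.range m, z ^ j / j.factorial

theorem hasDerivAt_expRemainder (m : ℕ) (z : ℂ) :
    HasDerivAt (expRemainder m) (expRemainder (m - 1) z) z := by
  have hs : ∀ m : ℕ, HasDerivAt (fun z : ℂ => ∑ j ∈ Finset.range m, z ^ j / j.factorial)
      (∑ j ∈ Finset.range (m - 1), z ^ j / j.factorial) z := by
    intro m
    have h := HasDerivAt.fun_sum (u := Finset.range m) (A := fun j (z : ℂ) => z ^ j / j.factorial)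
      (A' := fun j => (j : ℂ) * z ^ (j - 1) / j.factorial) (x := z)
      fun j _ => (hasDerivAt_pow j z).div_const _
    refine h.congr_deriv ?_
    cases m with
    | zero => simp
    | succ m =>
      rw [Finset.sum_range_succ']
      simp only [Nat.add_sub_cancel, Nat.cast_zero, zero_mul, zero_div, add_zero]
      refine Finset.sum_congr rfl fun j _ => ?_
      rw [Nat.factorial_succ]
      push_cast
      have h1 : (j : ℂ) + 1 ≠ 0 := by exact_mod_cast Nat.succ_ne_zero j
      have h2 : (j.factorial : ℂ) ≠ 0 := by exact_mod_cast j.factorial_ne_zero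
      field_simp
  exact (Complex.hasDerivAt_exp z).sub (hs m)

theorem norm_expRemainder_le (m : ℕ) (z : ℂ) :
    ‖expRemainder m z‖ ≤ (1 / 2) ^ m * Real.exp (2 * ‖z‖) := by
  refine (Complex.norm_exp_sub_sum_le_exp_norm_sub_sum z m).trans ?_
  set r := ‖z‖
  have hr : 0 ≤ r := norm_nonneg z
  have h1 : ∀ s : ℝ, HasSum (fun j : ℕ => s ^ j / j.factorial) (Real.exp s) := fun s => by
    rw [Real.exp_eq_exp_ℝ]
    exact NormedSpace.expSeries_div_hasSum_exp s
  have h2 := (h1 r).summable.sum_add_tsum_nat_add m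
  rw [(h1 r).tsum_eq] at h2
  have h3 := (h1 (2 * r)).summable.sum_add_tsum_nat_add m
  rw [(h1 (2 * r)).tsum_eq] at h3
  have h4 : ∑' i : ℕ, r ^ (i + m) / (i + m).factorial ≤
      ∑' i : ℕ, (1 / 2) ^ m * ((2 * r) ^ (i + m) / (i + m).factorial) := by
    refine ((summable_nat_add_iff m).2 (h1 r).summable).tsum_le_tsum (fun i => ?_)
      (((summable_nat_add_iff m).2 (h1 (2 * r)).summable).mul_left _)
    have : (1 / 2 : ℝ) ^ m * ((2 * r) ^ (i + m) / (i + m).factorial) =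
        2 ^ i * (r ^ (i + m) / (i + m).factorial) := by
      rw [mul_pow, pow_add 2, one_div, inv_pow]; field_simp
    rw [this]
    exact le_mul_of_one_le_left (by positivity) (one_le_pow₀ one_le_two)
  rw [tsum_mul_left] at h4
  have h5 : 0 ≤ ∑ j ∈ Finset.range m, (2 * r) ^ j / j.factorial := by positivity
  have h6 : ∑' i : ℕ, (2 * r) ^ (i + m) / (i + m).factorial ≤ Real.exp (2 * r) := by linarith
  calc _ = ∑' i : ℕ, r ^ (i + m) / (i + m).factorial := by linarith
    _ ≤ _ := h4
    _ ≤ _ := by gcongr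

theorem norm_iteratedFDeriv_integral_inner_le {E : Type} [NormedAddCommGroup E]
    [InnerProductSpace ℝ E] [FiniteDimensional ℝ E] [MeasurableSpace E] [BorelSpace E]
    {R : ℝ} (hR : 0 ≤ R) (l : ℕ) :
    ∀ {W : Type} [NormedAddCommGroup W] [NormedSpace ℝ W] [NormedSpace ℂ W] [IsScalarTower ℝ ℂ W]
      {κ : ℕ → ℝ → ℂ} (_ : ∀ i t, HasDerivAt (κ i) (κ (i + 1) t) t) {ψ : E → W}
      (_ : Continuous ψ) (_ : ∀ ξ, R < ‖ξ‖ → ψ ξ = 0) {x : E} {M : ℝ}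
      (_ : ∀ t, |t| ≤ R * ‖x‖ → ‖κ l t‖ ≤ M),
      ‖iteratedFDeriv ℝ l (fun x => ∫ ξ, κ 0 (inner ℝ ξ x) • ψ ξ) x‖ ≤ R ^ l * M * ∫ ξ, ‖ψ ξ‖ := by
  induction l with
  | zero =>
    intro W _ _ _ _ κ hκ ψ hψ hψR x M hM
    have hcs : HasCompactSupport ψ :=
      HasCompactSupport.intro (isCompact_closedBall (0 : E) R) fun ξ h => hψR ξ (by simpa using h)
    have hi : Integrable (fun ξ => ‖ψ ξ‖) := (hψ.integrable_of_hasCompactSupport hcs).norm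
    rw [norm_iteratedFDeriv_zero, pow_zero, one_mul, ← integral_const_mul]
    refine norm_integral_le_of_norm_le (hi.const_mul M) (Filter.Eventually.of_forall fun ξ => ?_)
    rw [norm_smul]
    by_cases h : R < ‖ξ‖
    · simp [hψR ξ h]
    · gcongr
      exact hM _ ((abs_real_inner_le_norm _ _).trans (by gcongr; linarith))
  | succ l ih =>
    intro W _ _ _ _ κ hκ ψ hψ hψR x M hM
    have hcs : HasCompactSupport ψ :=
      HasCompactSupport.intro (isCompact_closedBall (0 : E) R) fun ξ h => hψR ξ (by simpa using h)
    have hi : Integrable (fun ξ => ‖ψ ξ‖) := (hψ.integrable_of_hasCompactSupport hcs).norm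
    have hκc : ∀ i, Continuous (κ i) := fun i =>
      continuous_iff_continuousAt.2 fun t => (hκ i t).continuousAt
    let ψ' : E → E →L[ℝ] W := fun ξ => (innerSL ℝ ξ).smulRight (ψ ξ)
    have hψ' : Continuous ψ' :=
      ((ContinuousLinearMap.smulRightL ℝ E W).continuous₂).comp
        ((innerSL ℝ (E := E)).continuous.prodMk hψ)
    have hψ'R : ∀ ξ, R < ‖ξ‖ → ψ' ξ = 0 := fun ξ h => by ext; simp [ψ', hψR ξ h]
    have hn : ∀ ξ, ‖ψ' ξ‖ ≤ R * ‖ψ ξ‖ := fun ξ => by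
      by_cases h : R < ‖ξ‖
      · rw [hψ'R ξ h, norm_zero]; positivity
      · rw [ContinuousLinearMap.norm_smulRight_apply, innerSL_apply_norm]
        gcongr; linarith
    have hcs' : HasCompactSupport ψ' :=
      HasCompactSupport.intro (isCompact_closedBall (0 : E) R) fun ξ h => hψ'R ξ (by simpa using h)
    have hi' : Integrable (fun ξ => ‖ψ' ξ‖) := (hψ'.integrable_of_hasCompactSupport hcs').norm
    have hderiv : ∀ x : E, HasFDerivAt (fun x => ∫ ξ, κ 0 (inner ℝ ξ x) • ψ ξ)
        (∫ ξ, κ 1 (inner ℝ ξ x) • ψ' ξ) x := by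
      intro x
      obtain ⟨B, hB⟩ :=
        (isCompact_Icc (a := -(R * (‖x‖ + 1))) (b := R * (‖x‖ + 1))).exists_bound_of_continuousOn
        (hκc 1).continuousOn
      have hc0 : ∀ y, Continuous fun ξ => κ 0 (inner ℝ ξ y) • ψ ξ := fun y =>
        ((hκc 0).comp (continuous_id.inner continuous_const)).smul hψ
      have hc1 : Continuous fun ξ => κ 1 (inner ℝ ξ x) • ψ' ξ :=
        ((hκc 1).comp (continuous_id.inner continuous_const)).smul hψ'
      refine hasFDerivAt_integral_of_dominated_of_fderiv_le (s := Metric.ball x 1)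
        (F' := fun x ξ => κ 1 (inner ℝ ξ x) • ψ' ξ) (bound := fun ξ => B * ‖ψ' ξ‖)
        (Metric.ball_mem_nhds x one_pos)
        (Filter.Eventually.of_forall fun y => (hc0 y).aestronglyMeasurable)
        ((hc0 x).integrable_of_hasCompactSupport hcs.smul_left)
        hc1.aestronglyMeasurable (Filter.Eventually.of_forall fun ξ y hy => ?_)
        (hi'.const_mul B) (Filter.Eventually.of_forall fun ξ y _ => ?_)
      · rw [norm_smul]
        by_cases h : R < ‖ξ‖
        · simp [hψ'R ξ h]
        · gcongr
          refine hB _ (abs_le.1 ((abs_real_inner_le_norm _ _).trans ?_))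
          have h1 : ‖y‖ ≤ ‖x‖ + 1 := by
            have := norm_le_norm_add_norm_sub' y x
            have h2 := (mem_ball_iff_norm.1 hy).le
            linarith
          gcongr; linarith
      · have h1 : HasFDerivAt (fun y : E => inner ℝ ξ y) (innerSL ℝ ξ) y :=
          (innerSL ℝ ξ).hasFDerivAt
        have h2 := ((hκ 0 (inner ℝ ξ y)).hasFDerivAt.comp y h1).smul_const (ψ ξ)
        refine h2.congr_fderiv ?_
        ext v
        change (inner ℝ ξ v • κ 1 (inner ℝ ξ y)) • ψ ξ = κ 1 (inner ℝ ξ y) • inner ℝ ξ v • ψ ξ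
        rw [smul_assoc, smul_comm]
    rw [← norm_iteratedFDeriv_fderiv, funext fun x => (hderiv x).fderiv]
    refine (ih (κ := fun i => κ (i + 1)) (fun i => hκ (i + 1)) hψ' hψ'R hM).trans ?_
    have hM0 : 0 ≤ M := (norm_nonneg _).trans (hM 0 (by simp; positivity))
    calc _ ≤ R ^ l * M * ∫ ξ, R * ‖ψ ξ‖ := by
          exact mul_le_mul_of_nonneg_left (integral_mono hi' (hi.const_mul R) hn) (by positivity)
      _ = _ := by rw [integral_const_mul]; ring

end

section

open scoped ContDiff
open MeasureTheory SchwartzMap FourierTransform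

namespace SchwartzMap

variable {ι : Type} [Fintype ι]

/-- The standard Gaussian `exp (-‖x‖²)` as a Schwartz function. -/
noncomputable def gaussian (E : Type*) [NormedAddCommGroup E] [InnerProductSpace ℝ E] : 𝓢(E, ℂ) :=
  cexpNeg (fun x => ‖x‖ ^ 2) (by fun_prop) one_pos (fun x => (one_mul _).le)

theorem gaussian_apply {E : Type*} [NormedAddCommGroup E] [InnerProductSpace ℝ E] (x : E) :
    gaussian E x = Complex.exp (-((‖x‖ ^ 2 : ℝ) : ℂ)) := rfl

theorem exists_norm_pow_mul_iteratedFDeriv_gaussian_mul_le {E : Type} [NormedAddCommGroup E]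
    [InnerProductSpace ℝ E] (a : ℝ) (k l : ℕ) :
    ∃ B, 0 ≤ B ∧ ∀ h : E → ℂ, ContDiff ℝ ∞ h → ∀ M : ℝ, 0 ≤ M → ∀ x,
      (∀ i ≤ l, ‖iteratedFDeriv ℝ i h x‖ ≤ M * Real.exp (a * ‖x‖)) →
      ‖x‖ ^ k * ‖iteratedFDeriv ℝ l (fun x => gaussian E x * h x) x‖ ≤ B * M := by
  have hq : (fun x : E => ‖x‖ ^ 2).HasTemperateGrowth := by fun_prop
  choose m C hC hm using fun n => exists_norm_iteratedFDeriv_cexp_neg_le hq n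
  choose S hS0 hS using fun i => exists_one_add_pow_mul_exp_le (k + m i) a one_pos
  refine ⟨∑ i ∈ Finset.range (l + 1), l.choose i * (C i * S i),
    Finset.sum_nonneg fun i _ => by have := hC i; have := hS0 i; positivity, ?_⟩
  intro h hh M hM x hx
  refine (mul_le_mul_of_nonneg_left (norm_iteratedFDeriv_mul_le (N := ∞)
    ((gaussian E).smooth ⊤) hh x (by exact_mod_cast le_top)) (by positivity)).trans ?_
  rw [Finset.mul_sum, Finset.sum_mul]
  refine Finset.sum_le_sum fun i hi => ?_
  have h1 : ‖iteratedFDeriv ℝ i (gaussian E) x‖ ≤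
    C i * (1 + ‖x‖) ^ m i * Real.exp (-‖x‖ ^ 2) := hm i x
  have h2 := hx (l - i) (by omega)
  have h3 := hS i ‖x‖ (norm_nonneg x)
  have hCi := hC i
  calc _ ≤ (1 + ‖x‖) ^ k * (l.choose i * (C i * (1 + ‖x‖) ^ m i * Real.exp (-‖x‖ ^ 2)) *
        (M * Real.exp (a * ‖x‖))) := by gcongr; linarith
    _ = l.choose i * (C i * ((1 + ‖x‖) ^ (k + m i) *
        (Real.exp (-‖x‖ ^ 2) * Real.exp (a * ‖x‖)))) * M := by rw [pow_add]; ring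
    _ = l.choose i * (C i * ((1 + ‖x‖) ^ (k + m i) *
        Real.exp (a * ‖x‖ - 1 * ‖x‖ ^ 2))) * M := by rw [← Real.exp_add]; ring_nf
    _ ≤ _ := by gcongr

theorem monomial_hasTemperateGrowth {k : ℕ} (p : Fin k → ι) :
    (fun x : EuclideanSpace ℝ ι => ∏ j, (x (p j) : ℂ)).HasTemperateGrowth := by
  have h : ∀ i, (fun x : EuclideanSpace ℝ ι => (x i : ℂ)).HasTemperateGrowth := fun i =>
    (Complex.ofRealCLM ∘L EuclideanSpace.proj i).hasTemperateGrowth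
  suffices ∀ s : Finset (Fin k),
      (fun x : EuclideanSpace ℝ ι => ∏ j ∈ s, (x (p j) : ℂ)).HasTemperateGrowth from this _
  intro s
  induction s using Finset.induction_on with
  | empty => simp
  | insert a s ha ih =>
    simp only [Finset.prod_insert ha]
    exact (h (p a)).mul ih

theorem integral_inner_pow_mul {k : ℕ} {ψ : EuclideanSpace ℝ ι → ℂ} (hψ : Continuous ψ)
    (hcs : HasCompactSupport ψ) (c : ℂ) (x : EuclideanSpace ℝ ι) :
    ∫ ξ, (c * (inner ℝ ξ x : ℝ)) ^ k / k.factorial * ψ ξ =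
      ∑ p : Fin k → ι, (c ^ k / k.factorial * ∫ ξ, (∏ j, (ξ (p j) : ℂ)) * ψ ξ) *
        ∏ j, (x (p j) : ℂ) := by
  have e : ∀ ξ, (c * (inner ℝ ξ x : ℝ)) ^ k / k.factorial * ψ ξ =
      ∑ p : Fin k → ι, (c ^ k / k.factorial * ∏ j, (x (p j) : ℂ)) *
        ((∏ j, (ξ (p j) : ℂ)) * ψ ξ) := by
    intro ξ
    have : ((inner ℝ ξ x : ℝ) : ℂ) = ∑ i, (ξ i : ℂ) * (x i : ℂ) := by
      rw [PiLp.inner_apply]; push_cast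
      exact Finset.sum_congr rfl fun i _ => by simp [mul_comm]
    rw [mul_pow, this, Fintype.sum_pow, mul_div_right_comm, Finset.mul_sum, Finset.sum_mul]
    refine Finset.sum_congr rfl fun p _ => ?_
    rw [Finset.prod_mul_distrib]; ring
  simp_rw [e]
  rw [integral_finsetSum _ fun p _ => ?_]
  · refine Finset.sum_congr rfl fun p _ => ?_
    rw [integral_const_mul]; ring
  · refine Integrable.const_mul (Continuous.integrable_of_hasCompactSupport ?_ hcs.mul_left) _
    exact (monomial_hasTemperateGrowth p).1.continuous.mul hψ

/-- A tempered distribution that annihilates all polynomial multiples of the Gaussian is zero. -/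
theorem eq_zero_of_forall_monomial_mul_gaussian
    {T : 𝓢(EuclideanSpace ℝ ι, ℂ) →L[ℂ] ℂ}
    (hT : ∀ (k : ℕ) (p : Fin k → ι) (φ : 𝓢(EuclideanSpace ℝ ι, ℂ)),
      (∀ x, φ x = (∏ j, (x (p j) : ℂ)) * gaussian _ x) → T φ = 0) : T = 0 := by
  set E := EuclideanSpace ℝ ι with hE
  have hg : (gaussian E : E → ℂ).HasTemperateGrowth := (gaussian E).hasTemperateGrowth
  obtain ⟨N, C, hC, hb⟩ := exists_forall_norm_le_of_seminorm_le T
  have hF : T ∘L smulLeftCLM ℂ (gaussian E) ∘L fourierCLM ℂ 𝓢(E, ℂ) = 0 := by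
    refine eq_zero_of_forall_hasCompactSupport fun ψ hψ => ?_
    obtain ⟨R, hR0, hR⟩ : ∃ R : ℝ, 0 ≤ R ∧ ∀ ξ, R < ‖ξ‖ → ψ ξ = 0 := by
      obtain ⟨R, hR⟩ := hψ.isCompact.isBounded.subset_closedBall (0 : E)
      refine ⟨max R 0, le_max_right _ _, fun ξ hξ => image_eq_zero_of_notMem_tsupport fun h => ?_⟩
      have := hR h
      rw [mem_closedBall_zero_iff] at this
      linarith [le_max_left R 0]
    let c : ℂ := -2 * Real.pi * Complex.I
    -- the Gaussian times the Taylor polynomial of the Fourier transform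
    let P : ℕ → 𝓢(E, ℂ) := fun m => ∑ k ∈ Finset.range m, ∑ p : Fin k → ι,
      (c ^ k / k.factorial * ∫ ξ, (∏ j, (ξ (p j) : ℂ)) * ψ ξ) •
        smulLeftCLM ℂ (fun x : E => ∏ j, (x (p j) : ℂ)) (gaussian E)
    have hTP : ∀ m, T (P m) = 0 := by
      intro m
      simp only [P, map_sum, map_smul]
      refine Finset.sum_eq_zero fun k _ => Finset.sum_eq_zero fun p _ => ?_
      rw [hT k p _ fun x => by
        rw [smulLeftCLM_apply_apply (monomial_hasTemperateGrowth p), smul_eq_mul], smul_zero]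
    let κ : ℕ → ℕ → ℝ → ℂ := fun m i t => c ^ i * expRemainder (m - i) (c * t)
    have hκ : ∀ m i t, HasDerivAt (κ m i) (κ m (i + 1) t) t := by
      intro m i t
      have h1 : HasDerivAt (fun t : ℝ => c * (t : ℂ)) c t := by
        simpa using (Complex.ofRealCLM.hasDerivAt (x := t)).const_mul c
      have h2 := ((hasDerivAt_expRemainder (m - i) (c * t)).comp t h1).const_mul (c ^ i)
      refine h2.congr_deriv ?_
      simp only [κ, Nat.sub_sub]; ring
    let h : ℕ → E → ℂ := fun m x => ∫ ξ, κ m 0 (inner ℝ ξ x) • ψ ξ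
    have hint : ∀ f : ℝ → ℂ, Continuous f → ∀ x : E, Integrable fun ξ => f (inner ℝ ξ x) * ψ ξ :=
      fun f hf x => ((hf.comp (continuous_id.inner continuous_const)).mul
        ψ.continuous).integrable_of_hasCompactSupport hψ.mul_left
    have hpow : ∀ k : ℕ, Continuous fun t : ℝ => (c * t) ^ k / (k.factorial : ℂ) := fun k => by
      fun_prop
    have hh : ∀ m x, h m x = 𝓕 ψ x - ∑ k ∈ Finset.range m, ∑ p : Fin k → ι,
        (c ^ k / k.factorial * ∫ ξ, (∏ j, (ξ (p j) : ℂ)) * ψ ξ) * ∏ j, (x (p j) : ℂ) := by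
      intro m x
      rw [Finset.sum_congr rfl fun k _ =>
          (integral_inner_pow_mul (k := k) ψ.continuous hψ c x).symm,
        ← integral_finsetSum _ fun k _ => hint _ (hpow k) x, fourier_coe, Real.fourier_eq',
        ← integral_sub]
      · refine integral_congr_ae (Filter.Eventually.of_forall fun ξ => ?_)
        simp only [κ, expRemainder, smul_eq_mul, pow_zero, one_mul, Nat.sub_zero, sub_mul,
          Finset.sum_mul, c]
        congr 3
        push_cast; ring
      · refine (hint (fun t => Complex.exp ((-2 * Real.pi * t : ℝ) * Complex.I))
          (by fun_prop) x).congr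
          (Filter.Eventually.of_forall fun ξ => ?_)
        simp
      · exact integrable_finsetSum _ fun k _ => hint _ (hpow k) x
    have hhc : ∀ m, ContDiff ℝ ∞ (h m) := by
      intro m
      rw [funext (hh m)]
      refine ((𝓕 ψ).smooth ⊤).sub (ContDiff.sum fun k _ => ContDiff.sum fun p _ =>
        contDiff_const.mul (monomial_hasTemperateGrowth p).1)
    have hG : ∀ m, ((smulLeftCLM ℂ (gaussian E) (𝓕 ψ) - P m : 𝓢(E, ℂ)) : E → ℂ) =
        fun x => gaussian E x * h m x := by
      intro m
      ext x
      simp only [P, sub_apply, sum_apply, smul_apply, smulLeftCLM_apply_apply hg,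
        hh, smul_eq_mul, mul_sub,
        Finset.mul_sum]
      congr 1
      refine Finset.sum_congr rfl fun k _ => Finset.sum_congr rfl fun p _ => ?_
      rw [smulLeftCLM_apply_apply (monomial_hasTemperateGrowth p), smul_eq_mul]; ring
    let I := ∫ ξ, ‖ψ ξ‖
    have hI : 0 ≤ I := integral_nonneg fun _ => norm_nonneg _
    let D : ℝ := ∑ i ∈ Finset.range (N + 1), R ^ i * ‖c‖ ^ i * 2 ^ i * I
    have hD : 0 ≤ D := Finset.sum_nonneg fun _ _ => by positivity
    choose B hB0 hB using fun k l => exists_norm_pow_mul_iteratedFDeriv_gaussian_mul_le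
      (E := E) (2 * ‖c‖ * R) k l
    let S := ∑ k ∈ Finset.range (N + 1), ∑ l ∈ Finset.range (N + 1), B k l
    have hS : ∀ k ≤ N, ∀ l ≤ N, B k l ≤ S := fun k hk l hl =>
      (Finset.single_le_sum (f := fun l => B k l) (fun l _ => hB0 k l)
        (Finset.mem_range.2 (Nat.lt_succ_of_le hl))).trans
      (Finset.single_le_sum (f := fun k => ∑ l ∈ Finset.range (N + 1), B k l)
        (fun k _ => Finset.sum_nonneg fun l _ => hB0 k l)
        (Finset.mem_range.2 (Nat.lt_succ_of_le hk)))
    have hS0 : 0 ≤ S := (hB0 0 0).trans (hS 0 (Nat.zero_le _) 0 (Nat.zero_le _))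
    have hmain : ∀ m, N ≤ m → ‖T (smulLeftCLM ℂ (gaussian E) (𝓕 ψ))‖ ≤
        C * (S * (D * (1 / 2) ^ m)) := by
      intro m hm
      have e : T (smulLeftCLM ℂ (gaussian E) (𝓕 ψ)) =
          T (smulLeftCLM ℂ (gaussian E) (𝓕 ψ) - P m) := by rw [map_sub, hTP, sub_zero]
      rw [e]
      refine hb _ _ (by positivity) fun k hk l hl x => ?_
      rw [hG]
      refine (hB k l (h m) (hhc m) (D * (1 / 2) ^ m) (by positivity) x fun i hi => ?_).trans ?_
      · have hMi : ∀ t : ℝ, |t| ≤ R * ‖x‖ → ‖κ m i t‖ ≤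
            ‖c‖ ^ i * ((1 / 2) ^ (m - i) * Real.exp (2 * ‖c‖ * R * ‖x‖)) := by
          intro t ht
          simp only [κ]
          rw [norm_mul, norm_pow]
          gcongr
          refine (norm_expRemainder_le _ _).trans ?_
          rw [norm_mul, Complex.norm_real, Real.norm_eq_abs]
          refine mul_le_mul_of_nonneg_left (Real.exp_le_exp.2 ?_) (by positivity)
          calc 2 * (‖c‖ * |t|) ≤ 2 * (‖c‖ * (R * ‖x‖)) := by gcongr
            _ = _ := by ring
        refine (norm_iteratedFDeriv_integral_inner_le hR0 i (hκ m) ψ.continuous hR hMi).trans ?_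
        have h2 : (1 / 2 : ℝ) ^ (m - i) = 2 ^ i * (1 / 2) ^ m := by
          have : (1 / 2 : ℝ) ^ m = (1 / 2) ^ (m - i) * (1 / 2) ^ i := by
            rw [← pow_add]; congr 1; omega
          rw [this, one_div, inv_pow, inv_pow]; field_simp
        have h3 : R ^ i * ‖c‖ ^ i * 2 ^ i * I ≤ D :=
          Finset.single_le_sum (f := fun i => R ^ i * ‖c‖ ^ i * 2 ^ i * I)
            (fun _ _ => by positivity) (Finset.mem_range.2 (by omega))
        rw [h2]
        calc _ = (R ^ i * ‖c‖ ^ i * 2 ^ i * I) * (1 / 2) ^ m *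
              Real.exp (2 * ‖c‖ * R * ‖x‖) := by ring
          _ ≤ _ := by gcongr
      · gcongr
        exact hS k hk l hl
    have hlim : Filter.Tendsto (fun m : ℕ => C * (S * (D * (1 / 2 : ℝ) ^ m))) Filter.atTop
        (nhds 0) := by
      simpa using (((tendsto_pow_atTop_nhds_zero_of_lt_one (r := (1 / 2 : ℝ)) (by norm_num)
        (by norm_num)).const_mul D).const_mul S).const_mul C
    have := ge_of_tendsto hlim (Filter.eventually_atTop.2 ⟨N, hmain⟩)
    simpa using this
  have hF' : ∀ φ : 𝓢(E, ℂ), T (smulLeftCLM ℂ (gaussian E) φ) = 0 := by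
    intro φ
    have := congrArg (fun L => L (𝓕⁻ φ)) hF
    simpa using this
  refine eq_zero_of_forall_hasCompactSupport fun φ hφ => ?_
  have hcs : HasCompactSupport fun x => Complex.exp ((‖x‖ ^ 2 : ℝ) : ℂ) * φ x := hφ.mul_left
  have hcd : ContDiff ℝ ∞ fun x : E => Complex.exp ((‖x‖ ^ 2 : ℝ) : ℂ) * φ x :=
    (Complex.ofRealCLM.contDiff.comp (contDiff_norm_sq ℝ)).cexp.mul (φ.smooth ⊤)
  rw [← hF' (hcs.toSchwartzMap hcd)]
  congr 1
  ext x
  have : hcs.toSchwartzMap hcd x = Complex.exp ((‖x‖ ^ 2 : ℝ) : ℂ) * φ x := rfl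
  rw [smulLeftCLM_apply_apply hg, this, gaussian_apply, smul_eq_mul, ← mul_assoc,
    ← Complex.exp_add]
  simp

end SchwartzMap

end

/-- If a tensor `f` on index tuples is invariant under the commutator action of the matrix units
on the slots in `s` and all its contractions vanish, then it is zero. -/
theorem eq_zero_of_matrixUnit_invariant_of_contraction_eq_zero {κ ι : Type*} [Fintype κ]
    [DecidableEq κ] [Fintype ι] [DecidableEq ι] (s : Finset κ) (hs : s.Nonempty)
    (f : (κ → ι) → (κ → ι) → ℂ)
    (hinv : ∀ a b i j, ∑ k ∈ s, (if i k = a then f (Function.update i k b) j else 0) =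
      ∑ k ∈ s, (if j k = b then f i (Function.update j k a) else 0))
    (hcontr : ∀ k ∈ s, ∀ k' ∈ s, ∀ i j,
      ∑ a, f (Function.update i k a) (Function.update j k' a) = 0)
    (i j : κ → ι) : f i j = 0 := by
  let N : ι → ι → ((κ → ι) → ℂ) → (κ → ι) → ℂ := fun a b g i =>
    ∑ k ∈ s, if i k = a then g (Function.update i k b) else 0
  have hadj : ∀ a b g h, ∑ i, h i * N a b g i = ∑ i, N b a h i * g i := by
    intro a b g h
    simp only [N, Finset.mul_sum, Finset.sum_mul]
    rw [Finset.sum_comm, Finset.sum_comm (s := Finset.univ) (t := s)]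
    refine Finset.sum_congr rfl fun k _ => ?_
    simp only [mul_ite, ite_mul, mul_zero, zero_mul, ← Finset.sum_filter]
    refine Finset.sum_bij' (fun i _ => Function.update i k b) (fun i _ => Function.update i k a)
      ?_ ?_ ?_ ?_ ?_
    · intro i _; simp
    · intro i _; simp
    · intro i hi
      have : i k = a := by simpa using hi
      simp [← this]
    · intro i hi
      have : i k = b := by simpa using hi
      simp [← this]
    · intro i hi
      have : i k = a := by simpa using hi
      simp [← this]
  have hlap : ∀ i, ∑ a, ∑ b, N b a (N a b fun i => f i j) i = 0 := by
    intro i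
    have e : ∀ a b, N b a (N a b fun i => f i j) i = ∑ k ∈ s, ∑ k' ∈ s,
        if i k = b then if j k' = b then f (Function.update i k a) (Function.update j k' a) else 0
        else 0 := by
      intro a b
      simp only [N, hinv]
      refine Finset.sum_congr rfl fun k _ => ?_
      split_ifs <;> simp
    simp only [e]
    rw [Finset.sum_comm]
    simp_rw [Finset.sum_comm (s := Finset.univ) (t := s)]
    refine Finset.sum_eq_zero fun k hk => Finset.sum_eq_zero fun k' hk' => ?_
    refine Finset.sum_eq_zero fun b _ => ?_
    by_cases h1 : i k = b <;> by_cases h2 : j k' = b <;> simp [h1, h2, hcontr k hk k' hk']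
  have hN : ∀ a b i, N a b (fun i => f i j) i = 0 := by
    have hconj : ∀ a b i, (starRingEnd ℂ) (N a b (fun i => f i j) i) =
        N a b (fun i => (starRingEnd ℂ) (f i j)) i := by
      intro a b i
      simp only [N, map_sum]
      refine Finset.sum_congr rfl fun k _ => ?_
      split_ifs <;> simp
    have h0 : ∑ a, ∑ b, ∑ i, Complex.normSq (N a b (fun i => f i j) i) = 0 := by
      have : ((∑ a, ∑ b, ∑ i, Complex.normSq (N a b (fun i => f i j) i) : ℝ) : ℂ) = 0 := by
        push_cast
        simp_rw [Complex.normSq_eq_conj_mul_self, hconj, ← hadj]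
        simp_rw [Finset.sum_comm (s := (Finset.univ : Finset ι))
          (t := (Finset.univ : Finset (κ → ι))),
          ← Finset.mul_sum, hlap, mul_zero, Finset.sum_const_zero]
      exact_mod_cast this
    intro a b i
    have h1 := (Finset.sum_eq_zero_iff_of_nonneg fun a _ => Finset.sum_nonneg fun b _ =>
      Finset.sum_nonneg fun i _ => Complex.normSq_nonneg _).1 h0 a (Finset.mem_univ _)
    have h2 := (Finset.sum_eq_zero_iff_of_nonneg fun b _ =>
      Finset.sum_nonneg fun i _ => Complex.normSq_nonneg _).1 h1 b (Finset.mem_univ _)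
    have h3 := (Finset.sum_eq_zero_iff_of_nonneg fun i _ =>
      Complex.normSq_nonneg _).1 h2 i (Finset.mem_univ _)
    exact Complex.normSq_eq_zero.1 h3
  have hsum : ∑ a, N a a (fun i => f i j) i = s.card * f i j := by
    simp only [N]
    rw [Finset.sum_comm, Finset.sum_congr rfl fun k _ => Finset.sum_ite_eq _ _ _]
    simp
  simp only [hN, Finset.sum_const_zero] at hsum
  rcases mul_eq_zero.1 hsum.symm with h | h
  · exact absurd (by exact_mod_cast h) hs.card_ne_zero
  · exact h

namespace MvPolynomial

open Matrix

variable {ι : Type*}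

/-- The two matrices of independent variables, indexed by `Bool`. -/
noncomputable def genericMatrix (b : Bool) : Matrix ι ι (MvPolynomial (Bool × ι × ι) ℂ) :=
  Matrix.of fun i j => X (b, i, j)

/-- The algebra map which transposes both generic matrices. -/
noncomputable def transposeVars :
    MvPolynomial (Bool × ι × ι) ℂ →ₐ[ℂ] MvPolynomial (Bool × ι × ι) ℂ :=
  rename fun p => (p.1, p.2.2, p.2.1)

variable [Fintype ι]

/-- The derivation sending the generic matrix `W b` to the commutator `[A b, W b]`. -/
noncomputable def commutatorDerivation (A : Bool → Matrix ι ι ℂ) :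
    Derivation ℂ (MvPolynomial (Bool × ι × ι) ℂ) (MvPolynomial (Bool × ι × ι) ℂ) :=
  mkDerivation ℂ fun p =>
    ((A p.1).map C * genericMatrix p.1 - genericMatrix p.1 * (A p.1).map C :
      Matrix ι ι (MvPolynomial (Bool × ι × ι) ℂ)) p.2.1 p.2.2

theorem commutatorDerivation_X (A : Bool → Matrix ι ι ℂ) (p : Bool × ι × ι) :
    commutatorDerivation A (X p) =
      ((A p.1).map C * genericMatrix p.1 - genericMatrix p.1 * (A p.1).map C :
        Matrix ι ι (MvPolynomial (Bool × ι × ι) ℂ)) p.2.1 p.2.2 :=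
  mkDerivation_X _ _ _

variable [DecidableEq ι]

/-- The product of generic matrices spelled by a word. -/
noncomputable def wordMatrix (w : List Bool) : Matrix ι ι (MvPolynomial (Bool × ι × ι) ℂ) :=
  (w.map genericMatrix).prod

theorem wordMatrix_append (v w : List Bool) :
    (wordMatrix (v ++ w) : Matrix ι ι _) = wordMatrix v * wordMatrix w := by
  simp [wordMatrix]

theorem wordMatrix_cons (b : Bool) (w : List Bool) :
    (wordMatrix (b :: w) : Matrix ι ι _) = genericMatrix b * wordMatrix w := by
  simp [wordMatrix]

theorem totalDegree_wordMatrix_le (w : List Bool) (i j : ι) :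
    (wordMatrix w i j).totalDegree ≤ w.length := by
  induction w generalizing i j with
  | nil => by_cases h : i = j <;> simp [wordMatrix, h]
  | cons b w ih =>
    rw [wordMatrix_cons, Matrix.mul_apply]
    refine totalDegree_finsetSum_le fun k _ => (totalDegree_mul _ _).trans ?_
    have := ih k j
    have h1 : (genericMatrix b i k).totalDegree = 1 := by simp [genericMatrix]
    simp only [List.length_cons]
    omega

theorem totalDegree_trace_wordMatrix_le (w : List Bool) :
    (wordMatrix w : Matrix ι ι _).trace.totalDegree ≤ w.length :=
  totalDegree_finsetSum_le fun i _ => totalDegree_wordMatrix_le w i i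

theorem transposeVars_wordMatrix (w : List Bool) :
    (transposeVars (ι := ι)).mapMatrix (wordMatrix w) = (wordMatrix w.reverse)ᵀ := by
  induction w with
  | nil => simp [wordMatrix]
  | cons b w ih =>
    have h : (transposeVars (ι := ι)).mapMatrix (genericMatrix b) = (genericMatrix b)ᵀ := by
      ext1 i j
      simp [transposeVars, genericMatrix]
    rw [wordMatrix_cons, map_mul, ih, h, List.reverse_cons, wordMatrix_append, transpose_mul]
    simp [wordMatrix]

theorem transposeVars_trace_wordMatrix (w : List Bool) :
    transposeVars (wordMatrix w : Matrix ι ι _).trace = (wordMatrix w.reverse).trace := by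
  have := congrArg Matrix.trace (transposeVars_wordMatrix (ι := ι) w)
  simpa [Matrix.trace] using this

omit [DecidableEq ι] in
theorem map_derivation_mul
    (D : Derivation ℂ (MvPolynomial (Bool × ι × ι) ℂ) (MvPolynomial (Bool × ι × ι) ℂ))
    (M N : Matrix ι ι (MvPolynomial (Bool × ι × ι) ℂ)) :
    (M * N).map D = M.map D * N + M * N.map D := by
  ext1 i j
  simp only [Matrix.map_apply, Matrix.mul_apply, Matrix.add_apply, map_sum, Derivation.leibniz,
    ← Finset.sum_add_distrib, smul_eq_mul]
  exact Finset.sum_congr rfl fun k _ => by ring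

theorem map_commutatorDerivation_wordMatrix (A : Matrix ι ι ℂ) (w : List Bool) :
    (wordMatrix w).map (commutatorDerivation fun _ => A) =
      A.map C * wordMatrix w - wordMatrix w * A.map C := by
  induction w with
  | nil =>
    ext1 i j
    by_cases h : i = j <;> simp [wordMatrix, h]
  | cons b w ih =>
    have h : (genericMatrix b).map (commutatorDerivation fun _ => A) =
        A.map C * genericMatrix b - genericMatrix b * A.map C := by
      ext1 i j
      simp [genericMatrix, commutatorDerivation_X]
    rw [wordMatrix_cons, map_derivation_mul, ih, h]
    noncomm_ring

theorem commutatorDerivation_trace_wordMatrix (A : Matrix ι ι ℂ) (w : List Bool) :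
    commutatorDerivation (fun _ => A) (wordMatrix w).trace = 0 := by
  have := congrArg Matrix.trace (map_commutatorDerivation_wordMatrix A w)
  rw [Matrix.trace_sub, Matrix.trace_mul_comm, sub_self] at this
  simpa [Matrix.trace] using this

omit [DecidableEq ι] in
theorem totalDegree_commutatorDerivation_le (A : Bool → Matrix ι ι ℂ)
    (P : MvPolynomial (Bool × ι × ι) ℂ) :
    (commutatorDerivation A P).totalDegree ≤ P.totalDegree := by
  conv_lhs => rw [P.as_sum, map_sum]
  refine totalDegree_finsetSum_le fun m hm => ?_
  refine le_trans ?_ (le_totalDegree hm)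
  rw [commutatorDerivation, mkDerivation_monomial, Finsupp.sum]
  refine (totalDegree_smul_le _ _).trans (totalDegree_finsetSum_le fun p hp => ?_)
  have h1 : ((((A p.1).map C * genericMatrix p.1 - genericMatrix p.1 * (A p.1).map C :
      Matrix ι ι (MvPolynomial (Bool × ι × ι) ℂ))) p.2.1 p.2.2).totalDegree ≤ 1 := by
    refine (totalDegree_sub _ _).trans (max_le ?_ ?_) <;>
    · rw [Matrix.mul_apply]
      refine totalDegree_finsetSum_le fun k _ => (totalDegree_mul _ _).trans ?_
      simp [genericMatrix]
  have h2 : (m - Finsupp.single p 1).sum (fun _ e => e) + 1 ≤ m.sum fun _ e => e := by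
    have : m = (m - Finsupp.single p 1) + Finsupp.single p 1 := by
      refine (tsub_add_cancel_of_le ?_).symm
      rw [Finsupp.single_le_iff]
      exact Nat.one_le_iff_ne_zero.2 (Finsupp.mem_support_iff.1 hp)
    conv_rhs => rw [this]
    rw [Finsupp.sum_add_index' (by simp) (by simp)]
    simp
  rw [smul_eq_mul]
  refine (totalDegree_mul _ _).trans ?_
  have h3 : (monomial (m - Finsupp.single p 1) (m p : ℂ)).totalDegree ≤
      (m - Finsupp.single p 1).sum fun _ e => e := totalDegree_monomial_le _ _
  omega

theorem commutatorDerivation_single_wordMatrix (a b : ι) (w : List Bool) (i j : ι) :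
    commutatorDerivation (fun _ => Matrix.single a b 1) (wordMatrix w i j) =
      (if i = a then wordMatrix w b j else 0) - if j = b then wordMatrix w i a else 0 := by
  have := congrFun₂ (map_commutatorDerivation_wordMatrix (Matrix.single a b 1) w) i j
  rw [Matrix.map_apply] at this
  rw [this]
  have e : (Matrix.single a b (1 : ℂ)).map C =
      (Matrix.single a b 1 : Matrix ι ι (MvPolynomial (Bool × ι × ι) ℂ)) := by
    simp [Matrix.map_single]
  rw [e, Matrix.sub_apply]
  congr 1
  · rcases eq_or_ne i a with rfl | h
    · simp
    · simp [h]
  · rcases eq_or_ne j b with rfl | h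
    · simp
    · simp [h]

theorem commutatorDerivation_prod_trace_wordMatrix (A : Matrix ι ι ℂ) (L : List (List Bool)) :
    commutatorDerivation (fun _ => A) (L.map fun w => (wordMatrix w).trace).prod = 0 := by
  induction L with
  | nil => simp
  | cons w L ih =>
    rw [List.map_cons, List.prod_cons, Derivation.leibniz, ih,
      commutatorDerivation_trace_wordMatrix, smul_zero, smul_zero, add_zero]

theorem _root_.Derivation.apply_finsetProd {R S κ : Type*} [CommRing R] [CommRing S]
    [Algebra R S] [DecidableEq κ] (D : Derivation R S S) (s : Finset κ) (f : κ → S) :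
    D (∏ k ∈ s, f k) = ∑ k ∈ s, D (f k) * ∏ l ∈ s.erase k, f l := by
  induction s using Finset.induction_on with
  | empty => simp
  | insert k s hk ih =>
    rw [Finset.prod_insert hk, Derivation.leibniz, ih, Finset.sum_insert hk,
      Finset.erase_insert hk, smul_eq_mul, smul_eq_mul, Finset.mul_sum, add_comm, mul_comm]
    congr 1
    refine Finset.sum_congr rfl fun l hl => ?_
    rw [Finset.erase_insert_of_ne (by rintro rfl; exact hk hl), Finset.prod_insert (by simp [hk])]
    ring

/-- A functional `ℓ` on polynomials in two generic matrices satisfies this when it transforms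
under the commutator derivations as the functional `P ↦ T (P exp (-tr (x * xᴴ)))` does for
a distribution `T` invariant under conjugation. -/
def IsConjInvariant (ℓ : MvPolynomial (Bool × ι × ι) ℂ →ₗ[ℂ] ℂ) : Prop :=
  ∀ (A : Bool → Matrix ι ι ℂ) (P : MvPolynomial (Bool × ι × ι) ℂ),
    ℓ (commutatorDerivation A P) = ℓ (P * ((A true - A false).map C *
      (genericMatrix true * genericMatrix false - genericMatrix false * genericMatrix true)).trace)

namespace IsConjInvariant

variable {ℓ : MvPolynomial (Bool × ι × ι) ℂ →ₗ[ℂ] ℂ} {d : ℕ}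

theorem map_mul_commutator_apply (h : IsConjInvariant ℓ)
    (hd : ∀ P : MvPolynomial (Bool × ι × ι) ℂ, P.totalDegree < d → ℓ P = 0)
    {P : MvPolynomial (Bool × ι × ι) ℂ} (hP : P.totalDegree < d) (a b : ι) :
    ℓ (P * (genericMatrix true * genericMatrix false -
      genericMatrix false * genericMatrix true : Matrix ι ι _) a b) = 0 := by
  have := h (fun c => if c then Matrix.single b a 1 else 0) P
  rw [hd _ ((totalDegree_commutatorDerivation_le _ _).trans_lt hP)] at this
  simpa [Matrix.map_single, Matrix.trace_single_mul] using this.symm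

theorem map_trace_swap_mul (h : IsConjInvariant ℓ)
    (hd : ∀ P : MvPolynomial (Bool × ι × ι) ℂ, P.totalDegree < d → ℓ P = 0)
    (v u : List Bool) (Q : MvPolynomial (Bool × ι × ι) ℂ)
    (hQ : v.length + u.length + 2 + Q.totalDegree ≤ d) :
    ℓ ((wordMatrix (v ++ true :: false :: u)).trace * Q) =
      ℓ ((wordMatrix (v ++ false :: true :: u)).trace * Q) := by
  rw [← sub_eq_zero, ← map_sub, ← sub_mul, ← Matrix.trace_sub]
  have e : (wordMatrix (v ++ true :: false :: u) - wordMatrix (v ++ false :: true :: u) :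
      Matrix ι ι _) = wordMatrix v * (genericMatrix true * genericMatrix false -
      genericMatrix false * genericMatrix true) * wordMatrix u := by
    simp only [wordMatrix_append, wordMatrix_cons]
    noncomm_ring
  rw [e, Matrix.trace_mul_cycle, ← wordMatrix_append, Matrix.trace]
  simp only [Matrix.diag_apply, Matrix.mul_apply (M := wordMatrix _), Finset.sum_mul, map_sum]
  refine Finset.sum_eq_zero fun b _ => Finset.sum_eq_zero fun a _ => ?_
  rw [mul_right_comm]
  refine h.map_mul_commutator_apply hd ((totalDegree_mul _ _).trans_lt ?_) a b
  have := totalDegree_wordMatrix_le (u ++ v) b a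
  rw [List.length_append] at this
  omega

theorem map_trace_perm_mul (h : IsConjInvariant ℓ)
    (hd : ∀ P : MvPolynomial (Bool × ι × ι) ℂ, P.totalDegree < d → ℓ P = 0)
    {u u' : List Bool} (hu : u.Perm u') (v : List Bool) (Q : MvPolynomial (Bool × ι × ι) ℂ)
    (hQ : v.length + u.length + Q.totalDegree ≤ d) :
    ℓ ((wordMatrix (v ++ u)).trace * Q) = ℓ ((wordMatrix (v ++ u')).trace * Q) := by
  induction hu generalizing v with
  | nil => rfl
  | @cons b u u' _ ih =>
    simpa using ih (v ++ [b]) (by simp at hQ ⊢; omega)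
  | swap a b u =>
    have hQ' : v.length + u.length + 2 + Q.totalDegree ≤ d := by simp at hQ; omega
    cases a <;> cases b
    · rfl
    · exact h.map_trace_swap_mul hd v u Q hQ'
    · exact (h.map_trace_swap_mul hd v u Q hQ').symm
    · rfl
  | trans h1 _ ih1 ih2 =>
    exact (ih1 v hQ).trans (ih2 v (by rw [← h1.length_eq]; exact hQ))

theorem map_prod_trace_reverse_mul (h : IsConjInvariant ℓ)
    (hd : ∀ P : MvPolynomial (Bool × ι × ι) ℂ, P.totalDegree < d → ℓ P = 0)
    (L : List (List Bool)) (Q : MvPolynomial (Bool × ι × ι) ℂ)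
    (hQ : (L.map List.length).sum + Q.totalDegree ≤ d) :
    ℓ ((L.map fun w => (wordMatrix w).trace).prod * Q) =
      ℓ ((L.map fun w => (wordMatrix w.reverse).trace).prod * Q) := by
  induction L generalizing Q with
  | nil => rfl
  | cons w L ih =>
    simp only [List.map_cons, List.prod_cons, List.sum_cons] at hQ ⊢
    have h1 : ((L.map fun w => (wordMatrix (ι := ι) w).trace).prod).totalDegree ≤
        (L.map List.length).sum := by
      refine (totalDegree_list_prod _).trans ?_
      rw [List.map_map]
      exact List.sum_le_sum fun w _ => totalDegree_trace_wordMatrix_le w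
    rw [mul_assoc, ← List.nil_append w, h.map_trace_perm_mul hd w.reverse_perm.symm,
      List.nil_append, mul_left_comm, ih, mul_left_comm, mul_assoc]
    · rfl
    · have := totalDegree_mul (wordMatrix w.reverse : Matrix ι ι _).trace Q
      have h2 := totalDegree_trace_wordMatrix_le (ι := ι) w.reverse
      rw [List.length_reverse] at h2
      omega
    · have := totalDegree_mul (L.map fun w => (wordMatrix (ι := ι) w).trace).prod Q
      simp only [List.length_nil]
      omega

theorem map_prod_trace (h : IsConjInvariant ℓ) (hτ : ∀ P, ℓ (transposeVars P) = -ℓ P)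
    (hd : ∀ P : MvPolynomial (Bool × ι × ι) ℂ, P.totalDegree < d → ℓ P = 0)
    (L : List (List Bool)) (hL : (L.map List.length).sum ≤ d) :
    ℓ (L.map fun w => (wordMatrix w).trace).prod = 0 := by
  have h1 := h.map_prod_trace_reverse_mul hd L 1 (by simpa using hL)
  have h2 := hτ (L.map fun w => (wordMatrix w).trace).prod
  rw [mul_one, mul_one] at h1
  rw [map_list_prod, List.map_map] at h2
  simp only [Function.comp_def, transposeVars_trace_wordMatrix] at h2
  rw [← h1] at h2
  exact self_eq_neg.1 h2

theorem map_prod_wordMatrix (h : IsConjInvariant ℓ) (hτ : ∀ P, ℓ (transposeVars P) = -ℓ P)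
    (hd : ∀ P : MvPolynomial (Bool × ι × ι) ℂ, P.totalDegree < d → ℓ P = 0)
    {κ : Type*} [Fintype κ] [DecidableEq κ] (s : Finset κ) (w : κ → List Bool)
    (L : List (List Bool)) (i j : κ → ι)
    (hL : (L.map List.length).sum + ∑ k ∈ s, (w k).length ≤ d) :
    ℓ ((L.map fun w => (wordMatrix w).trace).prod * ∏ k ∈ s, wordMatrix (w k) (i k) (j k)) = 0 := by
  have hprod : ∀ (s : Finset κ), ∀ k ∈ s, ∀ (g : κ → ι → MvPolynomial (Bool × ι × ι) ℂ)
      (i : κ → ι) (a : ι), ∏ l ∈ s, g l (Function.update i k a l) =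
        g k a * ∏ l ∈ s.erase k, g l (i l) := by
    intro s k hk g i a
    rw [← Finset.mul_prod_erase s _ hk, Function.update_self]
    congr 1
    refine Finset.prod_congr rfl fun l hl => ?_
    rw [Function.update_of_ne (Finset.ne_of_mem_erase hl)]
  induction hs : s.card generalizing s w L i j with
  | zero =>
    obtain rfl := Finset.card_eq_zero.1 hs
    simpa using h.map_prod_trace hτ hd L (by simpa using hL)
  | succ m ih =>
    refine eq_zero_of_matrixUnit_invariant_of_contraction_eq_zero s
      (Finset.card_pos.1 (by omega)) (fun i j => ℓ ((L.map fun w => (wordMatrix w).trace).prod *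
        ∏ k ∈ s, wordMatrix (w k) (i k) (j k))) ?_ ?_ i j
    · intro a b i j
      have h0 := h (fun _ => Matrix.single a b 1)
        ((L.map fun w => (wordMatrix w).trace).prod * ∏ k ∈ s, wordMatrix (w k) (i k) (j k))
      rw [sub_self] at h0
      simp only [Matrix.map_zero C (map_zero C), Matrix.zero_mul, Matrix.trace_zero, mul_zero,
        map_zero] at h0
      rw [Derivation.leibniz, commutatorDerivation_prod_trace_wordMatrix, smul_zero, add_zero,
        Derivation.apply_finsetProd, smul_eq_mul, Finset.mul_sum, map_sum] at h0
      rw [← sub_eq_zero, ← Finset.sum_sub_distrib]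
      refine Eq.trans ?_ h0
      refine Finset.sum_congr rfl fun k hk => ?_
      have hi := hprod s k hk (fun l c => wordMatrix (w l) c (j l)) i b
      have hj := hprod s k hk (fun l c => wordMatrix (w l) (i l) c) j a
      rw [commutatorDerivation_single_wordMatrix, hi, hj]
      split_ifs <;> simp [sub_mul, mul_sub]
    · intro k hk k' hk' i j
      have hcard : (s.erase k).card = m := by rw [Finset.card_erase_of_mem hk]; omega
      have hsum := Finset.add_sum_erase s (fun k => (w k).length) hk
      rw [← map_sum, ← Finset.mul_sum]
      rcases eq_or_ne k' k with rfl | hne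
      · have e : ∀ a, ∏ l ∈ s, wordMatrix (w l) (Function.update i k' a l)
            (Function.update j k' a l) = wordMatrix (w k') a a *
              ∏ l ∈ s.erase k', wordMatrix (w l) (i l) (j l) := by
          intro a
          rw [← Finset.mul_prod_erase s _ hk]
          congr 1
          · simp
          · refine Finset.prod_congr rfl fun l hl => ?_
            simp [Finset.ne_of_mem_erase hl]
        simp only [e, ← Finset.sum_mul]
        have := ih (s.erase k') w (w k' :: L) i j (by simp; omega) hcard
        rw [← this, List.map_cons, List.prod_cons, ← mul_assoc, mul_comm (List.prod _)]
        rfl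
      · have hk'' : k' ∈ s.erase k := Finset.mem_erase.2 ⟨hne, hk'⟩
        have e : ∀ a, ∏ l ∈ s, wordMatrix (w l) (Function.update i k a l)
            (Function.update j k' a l) = wordMatrix (w k') (i k') a * wordMatrix (w k) a (j k) *
              ∏ l ∈ (s.erase k).erase k', wordMatrix (w l) (i l) (j l) := by
          intro a
          rw [← Finset.mul_prod_erase s _ hk, ← Finset.mul_prod_erase _ _ hk'', ← mul_assoc]
          congr 1
          · simp [hne, hne.symm, mul_comm]
          · refine Finset.prod_congr rfl fun l hl => ?_
            have h1 := Finset.ne_of_mem_erase hl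
            have h2 := Finset.ne_of_mem_erase (Finset.mem_of_mem_erase hl)
            simp [h1, h2]
        simp only [e, ← Finset.sum_mul]
        rw [← Matrix.mul_apply, ← wordMatrix_append]
        have hsum' := Finset.add_sum_erase (s.erase k) (fun k => (w k).length) hk''
        have hrest : ∀ l ∈ (s.erase k).erase k', l ≠ k' := fun l hl => Finset.ne_of_mem_erase hl
        have := ih (s.erase k) (Function.update w k' (w k' ++ w k)) L i
          (Function.update j k' (j k)) ?_ hcard
        · have e' : ∏ l ∈ s.erase k, wordMatrix (Function.update w k' (w k' ++ w k) l) (i l)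
              (Function.update j k' (j k) l) = wordMatrix (w k' ++ w k) (i k') (j k) *
                ∏ l ∈ (s.erase k).erase k', wordMatrix (w l) (i l) (j l) := by
            rw [← Finset.mul_prod_erase _ _ hk'', Function.update_self, Function.update_self]
            refine congrArg _ (Finset.prod_congr rfl fun l hl => ?_)
            rw [Function.update_of_ne (hrest l hl), Function.update_of_ne (hrest l hl)]
          rw [← this, e']
        · rw [← Finset.add_sum_erase _ _ hk'', Finset.sum_congr rfl fun l hl => by
            rw [Function.update_of_ne (hrest l hl)]]
          simp
          omega

theorem map_monomial (h : IsConjInvariant ℓ) (hτ : ∀ P, ℓ (transposeVars P) = -ℓ P)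
    (hd : ∀ P : MvPolynomial (Bool × ι × ι) ℂ, P.totalDegree < d → ℓ P = 0)
    (m : (Bool × ι × ι) →₀ ℕ) (hm : (m.sum fun _ e => e) ≤ d) (c : ℂ) :
    ℓ (monomial m c) = 0 := by
  have hL : (Multiset.ofList (Finsupp.toMultiset m).toList) = Finsupp.toMultiset m :=
    Multiset.coe_toList _
  set L := (Finsupp.toMultiset m).toList with hLdef
  have hcard : L.length = m.sum fun _ e => e := by
    rw [← Multiset.coe_card, hL, Finsupp.card_toMultiset]
    rfl
  have e1 : (monomial m c : MvPolynomial (Bool × ι × ι) ℂ) =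
      c • ∏ k : Fin L.length, X (L.get k) := by
    rw [← List.prod_ofFn, monomial_eq, ← C_mul']
    congr 1
    have e2 : m.prod (fun p e => (X p : MvPolynomial (Bool × ι × ι) ℂ) ^ e) =
        ((Finsupp.toMultiset m).map X).prod := by
      rw [Finsupp.toMultiset_map, Finsupp.prod_toMultiset,
        Finsupp.prod_mapDomain_index (by simp) (by simp [pow_add])]
    rw [e2, ← hL, Multiset.map_coe, Multiset.prod_coe]
    change _ = (List.ofFn (X ∘ L.get)).prod
    rw [← List.map_ofFn, List.ofFn_get]
  have := h.map_prod_wordMatrix hτ hd (Finset.univ : Finset (Fin L.length))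
    (fun k => [(L.get k).1]) [] (fun k => (L.get k).2.1) (fun k => (L.get k).2.2)
    (by simpa using hcard.trans_le hm)
  rw [e1, map_smul]
  simp [wordMatrix, genericMatrix] at this
  simp [this]

/-- A conjugation invariant functional which is odd under transposition is zero. -/
theorem eq_zero (h : IsConjInvariant ℓ) (hτ : ∀ P, ℓ (transposeVars P) = -ℓ P) : ℓ = 0 := by
  have key : ∀ d : ℕ, ∀ P : MvPolynomial (Bool × ι × ι) ℂ, P.totalDegree < d → ℓ P = 0 := by
    intro d
    induction d with
    | zero => intro P hP; omega
    | succ d ih =>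
      intro P hP
      rw [P.as_sum, map_sum]
      exact Finset.sum_eq_zero fun m hm => h.map_monomial hτ ih m
        ((le_totalDegree hm).trans (by omega)) _
  refine LinearMap.ext fun P => ?_
  exact key _ P (Nat.lt_succ_self _)

end IsConjInvariant

end MvPolynomial

namespace Matrix

theorem submodule_eq_top_of_sq_zero_mem {ι : Type*} [Fintype ι] [DecidableEq ι]
    (U : Submodule ℂ (Matrix ι ι ℂ)) (h1 : 1 ∈ U) (h0 : ∀ A : Matrix ι ι ℂ, A * A = 0 → A ∈ U) :
    U = ⊤ := by
  have hne : ∀ a b : ι, a ≠ b → Matrix.single a b (1 : ℂ) ∈ U := fun a b hab =>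
    h0 _ (by simp [hab.symm])
  have hsub : ∀ a b : ι, Matrix.single a a (1 : ℂ) - Matrix.single b b 1 ∈ U := by
    intro a b
    rcases eq_or_ne a b with rfl | hab
    · simp
    · have := h0 (Matrix.single a a 1 - Matrix.single b b 1 - Matrix.single a b 1 +
        Matrix.single b a 1) (by
          simp [Matrix.mul_add, Matrix.add_mul, Matrix.mul_sub, Matrix.sub_mul, hab, hab.symm]
          abel)
      have h2 := U.sub_mem (U.add_mem this (hne a b hab)) (hne b a hab.symm)
      convert h2 using 1
      abel
  have hdiag : ∀ a : ι, Matrix.single a a (1 : ℂ) ∈ U := by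
    intro a
    have h2 : (∑ b : ι, Matrix.single b b (1 : ℂ)) = 1 := by
      ext i j
      rcases eq_or_ne i j with rfl | hij
      · simp [Matrix.sum_apply, Matrix.single_apply]
      · rw [Matrix.sum_apply, Matrix.one_apply_ne hij]
        exact Finset.sum_eq_zero fun b _ => Matrix.single_apply_of_ne _ _ _ _ _ (by grind)
    have h3 : (1 : Matrix ι ι ℂ) + ∑ b : ι, (Matrix.single a a (1 : ℂ) - Matrix.single b b 1) =
        (Fintype.card ι : ℂ) • Matrix.single a a (1 : ℂ) := by
      rw [Finset.sum_sub_distrib, h2]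
      simp
    have h4 := U.add_mem h1 (U.sum_mem fun b (_ : b ∈ Finset.univ) => hsub a b)
    rw [h3] at h4
    have hc : (Fintype.card ι : ℂ) ≠ 0 := by
      have : Nonempty ι := ⟨a⟩
      exact_mod_cast Fintype.card_ne_zero
    exact (U.smul_mem_iff hc).1 h4
  refine eq_top_iff.2 fun A _ => ?_
  rw [Matrix.matrix_eq_sum_single A]
  refine U.sum_mem fun a _ => U.sum_mem fun b _ => ?_
  have : Matrix.single a b (A a b) = A a b • Matrix.single a b (1 : ℂ) := by simp
  rw [this]
  refine U.smul_mem _ ?_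
  rcases eq_or_ne a b with rfl | hab
  exacts [hdiag a, hne a b hab]

end Matrix

namespace MvPolynomial

open Matrix

variable {ι : Type*} [Fintype ι]

theorem commutatorDerivation_add (A B : Bool → Matrix ι ι ℂ) :
    commutatorDerivation (A + B) = commutatorDerivation A + commutatorDerivation B := by
  refine derivation_ext fun p => ?_
  simp only [commutatorDerivation_X, Derivation.add_apply, Pi.add_apply,
    Matrix.map_add C (map_add C), Matrix.add_mul, Matrix.mul_add, Matrix.sub_apply,
    Matrix.add_apply]
  ring

theorem commutatorDerivation_smul (c : ℂ) (A : Bool → Matrix ι ι ℂ) :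
    commutatorDerivation (c • A) = c • commutatorDerivation A := by
  refine derivation_ext fun p => ?_
  have : (c • A p.1).map C = (C c : MvPolynomial (Bool × ι × ι) ℂ) •
      ((A p.1).map C : Matrix ι ι (MvPolynomial (Bool × ι × ι) ℂ)) := by
    ext1 i j
    simp
  simp only [commutatorDerivation_X, Derivation.smul_apply, Pi.smul_apply, this, Matrix.smul_mul,
    Matrix.mul_smul, Matrix.sub_apply, Matrix.smul_apply, smul_eq_mul, MvPolynomial.smul_eq_C_mul]
  ring

variable [DecidableEq ι]

theorem isConjInvariant_of_sq_zero {ℓ : MvPolynomial (Bool × ι × ι) ℂ →ₗ[ℂ] ℂ}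
    (h : ∀ (A : Matrix ι ι ℂ), A * A = 0 → ∀ P : MvPolynomial (Bool × ι × ι) ℂ,
      ℓ (commutatorDerivation (fun b => if b then A else -Aᴴ) P) = ℓ (P * ((A + Aᴴ).map C *
        (genericMatrix true * genericMatrix false -
          genericMatrix false * genericMatrix true)).trace)) :
    IsConjInvariant ℓ := by
  let K : Matrix ι ι (MvPolynomial (Bool × ι × ι) ℂ) :=
    genericMatrix true * genericMatrix false - genericMatrix false * genericMatrix true
  let S : Submodule ℂ (Bool → Matrix ι ι ℂ) :=
    { carrier := {A | ∀ P : MvPolynomial (Bool × ι × ι) ℂ, ℓ (commutatorDerivation A P) =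
        ℓ (P * ((A true - A false).map C * K).trace)}
      zero_mem' := by
        intro P
        have : commutatorDerivation (0 : Bool → Matrix ι ι ℂ) = 0 := by
          simpa using commutatorDerivation_smul 0 (0 : Bool → Matrix ι ι ℂ)
        simp [this, Matrix.map_zero C (map_zero C)]
      add_mem' := by
        intro A B hA hB P
        have e : ((A + B) true - (A + B) false).map C =
            ((A true - A false).map C + (B true - B false).map C :
              Matrix ι ι (MvPolynomial (Bool × ι × ι) ℂ)) := by
          ext1 i j
          simp
          ring
        rw [commutatorDerivation_add, Derivation.add_apply, map_add, hA, hB, e, Matrix.add_mul,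
          Matrix.trace_add, mul_add, map_add]
      smul_mem' := by
        intro c A hA P
        have e : ((c • A) true - (c • A) false).map C =
            ((C c : MvPolynomial (Bool × ι × ι) ℂ) • (A true - A false).map C :
              Matrix ι ι (MvPolynomial (Bool × ι × ι) ℂ)) := by
          ext1 i j
          simp
          ring
        rw [commutatorDerivation_smul, Derivation.smul_apply, map_smul, hA, e, Matrix.smul_mul,
          Matrix.trace_smul, smul_eq_mul (a := C c), mul_left_comm, ← smul_eq_C_mul, map_smul] }
  have hS : ∀ A : Matrix ι ι ℂ, A * A = 0 → (fun b => if b then A else -Aᴴ) ∈ S := by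
    intro A hA P
    have := h A hA P
    simpa only [if_true, Bool.false_eq_true, if_false, sub_neg_eq_add] using this
  have hone : ∀ z : Bool → ℂ, (fun b => z b • (1 : Matrix ι ι ℂ)) ∈ S := by
    intro z P
    have e : ∀ c : ℂ, (c • (1 : Matrix ι ι ℂ)).map C =
        (C c : MvPolynomial (Bool × ι × ι) ℂ) •
          (1 : Matrix ι ι (MvPolynomial (Bool × ι × ι) ℂ)) := by
      intro c
      ext1 i j
      by_cases hij : i = j <;> simp [hij]
    have h1 : commutatorDerivation (fun b => z b • (1 : Matrix ι ι ℂ)) = 0 := by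
      refine derivation_ext fun p => ?_
      simp [commutatorDerivation_X, e]
    rw [h1, ← sub_smul, e, Matrix.smul_mul, Matrix.one_mul, Matrix.trace_smul, Matrix.trace_sub,
      Matrix.trace_mul_comm, sub_self]
    simp
  have hS' : ∀ A : Matrix ι ι ℂ, A * A = 0 →
      (fun b => if b then A else 0) ∈ S ∧ (fun b => if b then 0 else Aᴴ) ∈ S := by
    intro A hA
    have m1 := hS A hA
    have m2 := S.smul_mem (-Complex.I) (hS (Complex.I • A) (by simp [hA]))
    constructor
    · convert S.smul_mem (1 / 2 : ℂ) (S.add_mem m1 m2) using 1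
      ext b i j
      cases b
      · simp [← mul_assoc]
      · simp [← mul_assoc]
        ring
    · convert S.smul_mem (1 / 2 : ℂ) (S.sub_mem m2 m1) using 1
      ext b i j
      cases b
      · simp [← mul_assoc]
        ring
      · simp [← mul_assoc]
  have htop : ∀ A : Matrix ι ι ℂ, (fun b => if b then A else 0) ∈ S := by
    let L : Matrix ι ι ℂ →ₗ[ℂ] (Bool → Matrix ι ι ℂ) :=
      LinearMap.single ℂ (fun _ => Matrix ι ι ℂ) true
    have hL : ∀ A, L A = fun b => if b then A else 0 := by
      intro A
      ext b
      cases b <;> simp [L]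
    have := submodule_eq_top_of_sq_zero_mem (S.comap L)
      (by
        rw [Submodule.mem_comap, hL]
        convert hone (fun b => if b then 1 else 0) using 2 with b
        cases b <;> simp)
      (fun A hA => by rw [Submodule.mem_comap, hL]; exact (hS' A hA).1)
    intro A
    rw [← hL, ← Submodule.mem_comap, this]
    trivial
  have hbot : ∀ A : Matrix ι ι ℂ, (fun b => if b then 0 else A) ∈ S := by
    let L : Matrix ι ι ℂ →ₗ[ℂ] (Bool → Matrix ι ι ℂ) :=
      LinearMap.single ℂ (fun _ => Matrix ι ι ℂ) false
    have hL : ∀ A, L A = fun b => if b then 0 else A := by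
      intro A
      ext b
      cases b <;> simp [L]
    have := submodule_eq_top_of_sq_zero_mem (S.comap L)
      (by
        rw [Submodule.mem_comap, hL]
        convert hone (fun b => if b then 0 else 1) using 2 with b
        cases b <;> simp)
      (fun A hA => by
        rw [Submodule.mem_comap, hL]
        have := (hS' Aᴴ (by rw [← Matrix.conjTranspose_mul, hA, Matrix.conjTranspose_zero])).2
        rwa [Matrix.conjTranspose_conjTranspose] at this)
    intro A
    rw [← hL, ← Submodule.mem_comap, this]
    trivial
  intro A
  have := S.add_mem (htop (A true)) (hbot (A false))
  have e : ((fun b => if b then A true else 0) + fun b => if b then 0 else A false) = A := by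
    ext b
    cases b <;> simp
  rw [e] at this
  exact this

omit [DecidableEq ι] in
theorem commutatorDerivation_trace_mul (A B : Matrix ι ι ℂ) :
    commutatorDerivation (fun b => if b then A else B)
      (genericMatrix true * genericMatrix false : Matrix ι ι _).trace = ((A - B).map C *
        (genericMatrix true * genericMatrix false -
          genericMatrix false * genericMatrix true)).trace := by
  have h : ∀ b, (genericMatrix b).map (commutatorDerivation fun b => if b then A else B) =
      ((if b then A else B).map C * genericMatrix b -
        genericMatrix b * (if b then A else B).map C : Matrix ι ι _) := by
    intro b
    ext1 i j
    simp [genericMatrix, commutatorDerivation_X]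
  have := congrArg Matrix.trace (map_derivation_mul
    (commutatorDerivation fun b => if b then A else B) (genericMatrix true) (genericMatrix false))
  rw [h, h] at this
  have e1 : (A - B).map C = (A.map C - B.map C : Matrix ι ι (MvPolynomial (Bool × ι × ι) ℂ)) := by
    ext1 i j
    simp
  have e2 (M : Matrix ι ι (MvPolynomial (Bool × ι × ι) ℂ)) :=
    Matrix.trace_mul_comm (genericMatrix true) (M * genericMatrix false)
  have e3 (M : Matrix ι ι (MvPolynomial (Bool × ι × ι) ℂ)) :=
    Matrix.trace_mul_comm (genericMatrix true * genericMatrix false) M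
  have e4 : ((genericMatrix true * genericMatrix false : Matrix ι ι _).map
      (commutatorDerivation fun b => if b then A else B)).trace =
      commutatorDerivation (fun b => if b then A else B)
        (genericMatrix true * genericMatrix false : Matrix ι ι _).trace := by
    simp [Matrix.trace]
  rw [← e4, this, e1]
  simp only [if_true, Bool.false_eq_true, if_false, Matrix.mul_sub, Matrix.sub_mul,
    Matrix.trace_sub, Matrix.trace_add, Matrix.mul_assoc] at e2 e3 ⊢
  rw [e2, e2, e3]
  ring

end MvPolynomial

open SchwartzMap Matrix

attribute [local instance] Matrix.normedAddCommGroup Matrix.normedSpace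

namespace MvPolynomial

variable {ι : Type}

/-- Evaluation of a polynomial in two generic matrices at `x` and `xᴴ`. -/
noncomputable def evalConjTranspose (x : Matrix ι ι ℂ) : MvPolynomial (Bool × ι × ι) ℂ →ₐ[ℂ] ℂ :=
  aeval fun p => (if p.1 then x else xᴴ) p.2.1 p.2.2

theorem evalConjTranspose_X (x : Matrix ι ι ℂ) (p : Bool × ι × ι) :
    evalConjTranspose x (X p) = (if p.1 then x else xᴴ) p.2.1 p.2.2 :=
  aeval_X _ _

theorem evalConjTranspose_transposeVars (x : Matrix ι ι ℂ) (P : MvPolynomial (Bool × ι × ι) ℂ) :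
    evalConjTranspose x (transposeVars P) = evalConjTranspose xᵀ P := by
  rw [transposeVars, evalConjTranspose, aeval_rename, evalConjTranspose]
  congr 2
  ext ⟨b, i, j⟩
  cases b <;> simp

theorem evalConjTranspose_genericMatrix (x : Matrix ι ι ℂ) (b : Bool) :
    (genericMatrix b).map (evalConjTranspose x) = if b then x else xᴴ := by
  ext1 i j
  simp [genericMatrix, evalConjTranspose_X]

variable [Fintype ι]

theorem hasTemperateGrowth_evalConjTranspose (P : MvPolynomial (Bool × ι × ι) ℂ) :
    (fun x : Matrix ι ι ℂ => evalConjTranspose x P).HasTemperateGrowth := by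
  induction P using MvPolynomial.induction_on with
  | C a => simp [evalConjTranspose, Function.HasTemperateGrowth.const]
  | add P Q hP hQ =>
    simp only [map_add]
    exact hP.add hQ
  | mul_X P p hP =>
    simp only [map_mul]
    refine hP.mul ?_
    obtain ⟨b, i, j⟩ := p
    simp only [evalConjTranspose_X]
    cases b
    · exact (Complex.conjCLE.toContinuousLinearMap ∘L
        (ContinuousLinearMap.proj (R := ℝ) (φ := fun _ : ι => ℂ) i) ∘L
        (ContinuousLinearMap.proj (R := ℝ) (φ := fun _ : ι => ι → ℂ) j)).hasTemperateGrowth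
    · exact ((ContinuousLinearMap.proj (R := ℝ) (φ := fun _ : ι => ℂ) j) ∘L
        (ContinuousLinearMap.proj (R := ℝ) (φ := fun _ : ι => ι → ℂ) i)).hasTemperateGrowth

theorem evalConjTranspose_trace_mul (x : Matrix ι ι ℂ) :
    evalConjTranspose x (genericMatrix true * genericMatrix false : Matrix ι ι _).trace =
      ((∑ i, ∑ j, ‖x i j‖ ^ 2 : ℝ) : ℂ) := by
  simp [Matrix.trace, Matrix.mul_apply, genericMatrix, evalConjTranspose_X, ← Complex.mul_conj']

theorem map_commutatorDerivation_genericMatrix (x A : Matrix ι ι ℂ) (b : Bool) :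
    ((genericMatrix b).map (commutatorDerivation fun b => if b then A else -Aᴴ)).map
      (evalConjTranspose x) = if b then A * x - x * A else (A * x - x * A)ᴴ := by
  have h : ((genericMatrix b).map (commutatorDerivation fun b => if b then A else -Aᴴ)) =
      (if b then A else -Aᴴ).map C * genericMatrix b -
        genericMatrix b * (if b then A else -Aᴴ).map C := by
    ext1 i j
    simp [genericMatrix, commutatorDerivation_X]
  have hC : ∀ B : Matrix ι ι ℂ, (B.map C).map (evalConjTranspose x) = B := by
    intro B
    ext1 i j
    simp [evalConjTranspose]
  rw [h, Matrix.map_sub (evalConjTranspose x) (map_sub _), Matrix.map_mul, Matrix.map_mul, hC,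
    evalConjTranspose_genericMatrix]
  cases b
  · simp [sub_eq_add_neg, add_comm]
  · simp

variable [DecidableEq ι]

theorem hasDerivAt_evalConjTranspose (A x : Matrix ι ι ℂ) (P : MvPolynomial (Bool × ι × ι) ℂ) :
    HasDerivAt (fun s : ℝ => evalConjTranspose ((1 + s • A) * x * (1 - s • A)) P)
      (evalConjTranspose x (commutatorDerivation (fun b => if b then A else -Aᴴ) P)) 0 := by
  have hx : ∀ i j, HasDerivAt (fun s : ℝ => ((1 + s • A) * x * (1 - s • A)) i j)
      ((A * x - x * A) i j) 0 := by
    intro i j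
    have e : ∀ s : ℝ, ((1 + s • A) * x * (1 - s • A)) i j =
        x i j + s * (A * x - x * A) i j - s ^ 2 * (A * x * A) i j := by
      intro s
      have : (1 + s • A) * x * (1 - s • A) = x + s • (A * x - x * A) - s ^ 2 • (A * x * A) := by
        simp only [add_mul, mul_sub, one_mul, mul_one, smul_mul_assoc, mul_smul_comm, smul_sub,
          smul_add, pow_two, mul_smul]
        abel
      rw [this]
      simp
    simp only [e]
    have h1 : HasDerivAt (fun s : ℝ => (s : ℂ)) 1 0 := Complex.ofRealCLM.hasDerivAt
    have h2 := ((h1.mul_const ((A * x - x * A) i j)).const_add (x i j)).sub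
      ((h1.pow 2).mul_const ((A * x * A) i j))
    exact h2.congr_deriv (by simp)
  induction P using MvPolynomial.induction_on with
  | C a => simpa using hasDerivAt_const (0 : ℝ) a
  | add P Q hP hQ =>
    simp only [map_add]
    exact hP.add hQ
  | mul_X P p hP =>
    have hp : HasDerivAt (fun s : ℝ => evalConjTranspose ((1 + s • A) * x * (1 - s • A)) (X p))
        (evalConjTranspose x (commutatorDerivation (fun b => if b then A else -Aᴴ) (X p))) 0 := by
      obtain ⟨b, i, j⟩ := p
      have e := congrFun₂ (map_commutatorDerivation_genericMatrix x A b) i j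
      rw [Matrix.map_apply, Matrix.map_apply, genericMatrix, Matrix.of_apply] at e
      rw [e]
      simp only [evalConjTranspose_X]
      cases b
      · exact (hx j i).star
      · exact hx i j
    have := hP.mul hp
    simp only [map_mul, Derivation.leibniz, map_add, smul_eq_mul]
    exact this.congr_deriv (by simp; ring)

end MvPolynomial

namespace SchwartzMap

open MvPolynomial LineDeriv

variable {ι : Type} [Fintype ι]

theorem hasTemperateGrowth_sum_norm_sq :
    (fun x : Matrix ι ι ℂ => ∑ i, ∑ j, ‖x i j‖ ^ 2).HasTemperateGrowth := by
  refine Function.HasTemperateGrowth.sum fun i _ => Function.HasTemperateGrowth.sum fun j _ => ?_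
  exact (Function.hasTemperateGrowth_norm_sq (H := ℂ)).comp
    ((ContinuousLinearMap.proj (R := ℝ) (φ := fun _ : ι => ℂ) j) ∘L
        (ContinuousLinearMap.proj (R := ℝ) (φ := fun _ : ι => ι → ℂ) i)).hasTemperateGrowth

theorem norm_sq_le_sum_norm_sq (x : Matrix ι ι ℂ) : ‖x‖ ^ 2 ≤ ∑ i, ∑ j, ‖x i j‖ ^ 2 := by
  have h0 : ∀ i j, 0 ≤ ‖x i j‖ ^ 2 := fun i j => by positivity
  have h1 : ∀ i, 0 ≤ ∑ j, ‖x i j‖ ^ 2 := fun i => Finset.sum_nonneg fun j _ => h0 i j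
  have h2 : 0 ≤ ∑ i, ∑ j, ‖x i j‖ ^ 2 := Finset.sum_nonneg fun i _ => h1 i
  have : ‖x‖ ≤ √(∑ i, ∑ j, ‖x i j‖ ^ 2) := by
    refine (Matrix.norm_le_iff (Real.sqrt_nonneg _)).2 fun i j => Real.le_sqrt_of_sq_le ?_
    exact (Finset.single_le_sum (fun j _ => h0 i j) (Finset.mem_univ j)).trans
      (Finset.single_le_sum (fun i _ => h1 i) (Finset.mem_univ i))
  calc ‖x‖ ^ 2 ≤ √(∑ i, ∑ j, ‖x i j‖ ^ 2) ^ 2 := by gcongr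
    _ = _ := Real.sq_sqrt h2

/-- The Schwartz function `P(x, xᴴ) exp (-tr (x * xᴴ))`. -/
noncomputable def polyGaussian (P : MvPolynomial (Bool × ι × ι) ℂ) : 𝓢(Matrix ι ι ℂ, ℂ) :=
  smulLeftCLM ℂ (fun x : Matrix ι ι ℂ => evalConjTranspose x P)
    (cexpNeg _ hasTemperateGrowth_sum_norm_sq one_pos fun x => by
      rw [one_mul]; exact norm_sq_le_sum_norm_sq x)

theorem polyGaussian_apply (P : MvPolynomial (Bool × ι × ι) ℂ) (x : Matrix ι ι ℂ) :
    polyGaussian P x =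
      evalConjTranspose x P * Complex.exp (-((∑ i, ∑ j, ‖x i j‖ ^ 2 : ℝ) : ℂ)) := by
  rw [polyGaussian, smulLeftCLM_apply_apply (hasTemperateGrowth_evalConjTranspose P), smul_eq_mul,
    cexpNeg_apply]

/-- The functional `P ↦ T (P(x, xᴴ) exp (-tr (x * xᴴ)))`. -/
noncomputable def polyGaussianFunctional (T : 𝓢(Matrix ι ι ℂ, ℂ) →L[ℂ] ℂ) :
    MvPolynomial (Bool × ι × ι) ℂ →ₗ[ℂ] ℂ where
  toFun P := T (polyGaussian P)
  map_add' P Q := by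
    rw [← map_add]
    congr 1
    ext x
    simp [polyGaussian_apply, add_mul]
  map_smul' c P := by
    rw [RingHom.id_apply, ← map_smul]
    congr 1
    ext x
    simp [polyGaussian_apply, mul_assoc]

theorem polyGaussianFunctional_apply (T : 𝓢(Matrix ι ι ℂ, ℂ) →L[ℂ] ℂ)
    (P : MvPolynomial (Bool × ι × ι) ℂ) : polyGaussianFunctional T P = T (polyGaussian P) := rfl

/-- The polynomial flow `(s, x) ↦ (s, (1 + s A) x (1 - s A))`. -/
noncomputable def conjFlow [DecidableEq ι] (A : Matrix ι ι ℂ) (p : ℝ × Matrix ι ι ℂ) :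
    ℝ × Matrix ι ι ℂ :=
  (p.1, (1 + p.1 • A) * p.2 * (1 - p.1 • A))

variable [DecidableEq ι]

theorem conjFlow_neg_conjFlow {A : Matrix ι ι ℂ} (hA : A * A = 0) (p : ℝ × Matrix ι ι ℂ) :
    conjFlow (-A) (conjFlow A p) = p := by
  obtain ⟨s, x⟩ := p
  have h1 : (1 - s • A) * (1 + s • A) = 1 := by
    simp [mul_add, sub_mul, hA]
  have e : (1 + s • -A) * ((1 + s • A) * x * (1 - s • A)) * (1 - s • -A) =
      ((1 - s • A) * (1 + s • A)) * x * ((1 - s • A) * (1 + s • A)) := by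
    simp only [smul_neg, sub_neg_eq_add, ← sub_eq_add_neg, mul_assoc]
  simp only [conjFlow, e, h1, one_mul, mul_one]

theorem hasTemperateGrowth_conjFlow (A : Matrix ι ι ℂ) : (conjFlow A).HasTemperateGrowth := by
  let L1 : (ℝ × Matrix ι ι ℂ) →L[ℝ] (ℝ × Matrix ι ι ℂ) := LinearMap.toContinuousLinearMap
    (LinearMap.inr ℝ ℝ _ ∘ₗ (LinearMap.mulLeft ℝ A - LinearMap.mulRight ℝ A) ∘ₗ
      LinearMap.snd ℝ ℝ _)
  let L2 : (ℝ × Matrix ι ι ℂ) →L[ℝ] (ℝ × Matrix ι ι ℂ) := LinearMap.toContinuousLinearMap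
    (LinearMap.inr ℝ ℝ _ ∘ₗ (LinearMap.mulLeft ℝ A ∘ₗ LinearMap.mulRight ℝ A) ∘ₗ
      LinearMap.snd ℝ ℝ _)
  have e : conjFlow A = fun p : ℝ × Matrix ι ι ℂ =>
      p + ((ContinuousLinearMap.fst ℝ ℝ (Matrix ι ι ℂ) p) • L1 p -
        (ContinuousLinearMap.fst ℝ ℝ (Matrix ι ι ℂ) p) ^ 2 • L2 p) := by
    funext ⟨s, x⟩
    refine Prod.ext ?_ ?_
    · simp [conjFlow, L1, L2]
    · simp only [conjFlow, L1, L2, LinearMap.coe_toContinuousLinearMap', LinearMap.comp_apply,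
        LinearMap.snd_apply, LinearMap.inr_apply, LinearMap.sub_apply, LinearMap.mulLeft_apply,
        LinearMap.mulRight_apply, Prod.snd_add, Prod.snd_sub, Prod.smul_snd,
        ContinuousLinearMap.coe_fst', add_mul, mul_sub, one_mul, mul_one, smul_mul_assoc,
        mul_smul_comm, smul_sub, smul_add, pow_two, mul_smul, mul_assoc]
      abel
  rw [e]
  have h1 := (ContinuousLinearMap.fst ℝ ℝ (Matrix ι ι ℂ)).hasTemperateGrowth
  have h2 := L1.hasTemperateGrowth
  have h3 := L2.hasTemperateGrowth
  fun_prop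

omit [DecidableEq ι] in
theorem exists_polyGaussian_prod (P : MvPolynomial (Bool × ι × ι) ℂ) :
    ∃ F : 𝓢(ℝ × Matrix ι ι ℂ, ℂ),
      ∀ s x, F (s, x) = Complex.exp (-((s ^ 2 : ℝ) : ℂ)) * polyGaussian P x := by
  have h1 := (ContinuousLinearMap.fst ℝ ℝ (Matrix ι ι ℂ)).hasTemperateGrowth
  have h2 := (ContinuousLinearMap.snd ℝ ℝ (Matrix ι ι ℂ)).hasTemperateGrowth
  have hu : (fun p : ℝ × Matrix ι ι ℂ =>
      p.1 ^ 2 + ∑ i, ∑ j, ‖p.2 i j‖ ^ 2).HasTemperateGrowth :=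
    (h1.pow 2).add (hasTemperateGrowth_sum_norm_sq.comp h2)
  have huc : ∀ p : ℝ × Matrix ι ι ℂ, 1 * ‖p‖ ^ 2 ≤ p.1 ^ 2 + ∑ i, ∑ j, ‖p.2 i j‖ ^ 2 := by
    intro p
    have h := norm_sq_le_sum_norm_sq p.2
    have h3 : ‖p.1‖ ^ 2 = p.1 ^ 2 := by simp
    have h4 := sq_nonneg ‖p.1‖
    have h5 := sq_nonneg ‖p.2‖
    rw [one_mul, Prod.norm_def]
    rcases max_choice ‖p.1‖ ‖p.2‖ with h6 | h6 <;> rw [h6] <;> linarith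
  have hP : (fun p : ℝ × Matrix ι ι ℂ => evalConjTranspose p.2 P).HasTemperateGrowth :=
    (hasTemperateGrowth_evalConjTranspose P).comp h2
  refine ⟨smulLeftCLM ℂ (fun p : ℝ × Matrix ι ι ℂ => evalConjTranspose p.2 P)
    (cexpNeg _ hu one_pos huc), fun s x => ?_⟩
  rw [smulLeftCLM_apply_apply hP, smul_eq_mul, cexpNeg_apply, polyGaussian_apply, mul_left_comm,
    ← Complex.exp_add]
  congr 2
  push_cast
  ring

theorem polyGaussianFunctional_commutatorDerivation {T : 𝓢(Matrix ι ι ℂ, ℂ) →L[ℂ] ℂ}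
    (hT : ∀ (g : (Matrix ι ι ℂ)ˣ) (φ ψ : 𝓢(Matrix ι ι ℂ, ℂ)),
      (∀ x, ψ x = φ ((g : Matrix ι ι ℂ) * x * (↑g⁻¹ : Matrix ι ι ℂ))) → T ψ = T φ)
    (A : Matrix ι ι ℂ) (hA : A * A = 0) (P : MvPolynomial (Bool × ι × ι) ℂ) :
    polyGaussianFunctional T (commutatorDerivation (fun b => if b then A else -Aᴴ) P) =
      polyGaussianFunctional T (P * ((A + Aᴴ).map C *
        (genericMatrix true * genericMatrix false -
          genericMatrix false * genericMatrix true)).trace) := by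
  obtain ⟨F₀, hF₀⟩ := exists_polyGaussian_prod P
  have hupper : ∃ (k : ℕ) (c : ℝ), ∀ p, ‖p‖ ≤ c * (1 + ‖conjFlow A p‖) ^ k := by
    obtain ⟨k, c, h⟩ := (hasTemperateGrowth_conjFlow (-A)).2 0
    refine ⟨k, c, fun p => ?_⟩
    have := h (conjFlow A p)
    rwa [norm_iteratedFDeriv_zero, conjFlow_neg_conjFlow hA] at this
  let F : 𝓢(ℝ × Matrix ι ι ℂ, ℂ) := compCLM ℂ (hasTemperateGrowth_conjFlow A) hupper F₀
  have hF : ∀ s x, F (s, x) = Complex.exp (-((s ^ 2 : ℝ) : ℂ)) *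
      polyGaussian P ((1 + s • A) * x * (1 - s • A)) := fun s x => hF₀ _ _
  have hinr : ∃ (k : ℕ) (c : ℝ), ∀ x : Matrix ι ι ℂ,
      ‖x‖ ≤ c * (1 + ‖ContinuousLinearMap.inr ℝ ℝ (Matrix ι ι ℂ) x‖) ^ k :=
    ⟨1, 1, fun x => by simp⟩
  let R : 𝓢(ℝ × Matrix ι ι ℂ, ℂ) →L[ℂ] 𝓢(Matrix ι ι ℂ, ℂ) := compCLM ℂ
    (ContinuousLinearMap.inr ℝ ℝ (Matrix ι ι ℂ)).hasTemperateGrowth hinr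
  have hR : ∀ f x, R f x = f (0, x) := fun f x => rfl
  have hd := hasDerivAt_comp_translation (T ∘L R) ((1 : ℝ), (0 : Matrix ι ι ℂ)) F
  have hconst : ∀ s : ℝ, (T ∘L R) (compSubConstCLM ℝ (-(s • ((1 : ℝ), (0 : Matrix ι ι ℂ)))) F) =
      Complex.exp (-((s ^ 2 : ℝ) : ℂ)) * T (polyGaussian P) := by
    intro s
    let g : (Matrix ι ι ℂ)ˣ := ⟨1 + s • A, 1 - s • A, by simp [mul_sub, add_mul, hA],
      by simp [mul_add, sub_mul, hA]⟩
    have h1 := hT g (Complex.exp (-((s ^ 2 : ℝ) : ℂ)) • polyGaussian P)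
      (R (compSubConstCLM ℝ (-(s • ((1 : ℝ), (0 : Matrix ι ι ℂ)))) F)) (fun x => by
        have e : ((0 : ℝ), x) - -(s • ((1 : ℝ), (0 : Matrix ι ι ℂ))) = (s, x) := by simp
        rw [hR, compSubConstCLM_apply, e, hF]
        rfl)
    rw [map_smul, smul_eq_mul] at h1
    exact h1
  have hexp : HasDerivAt (fun s : ℝ => Complex.exp (-((s ^ 2 : ℝ) : ℂ))) 0 0 :=
    ((hasDerivAt_pow 2 (0 : ℝ)).ofReal_comp.fun_neg.cexp).congr_deriv (by simp)
  have hzero : T (R (∂_{((1 : ℝ), (0 : Matrix ι ι ℂ))} F)) = 0 := by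
    have h1 := hexp.mul_const (T (polyGaussian P))
    rw [zero_mul] at h1
    simp only [hconst] at hd
    exact hd.unique h1
  have hslice : R (∂_{((1 : ℝ), (0 : Matrix ι ι ℂ))} F) = polyGaussian
      (commutatorDerivation (fun b => if b then A else -Aᴴ) P) - polyGaussian (P * ((A + Aᴴ).map C *
        (genericMatrix true * genericMatrix false -
          genericMatrix false * genericMatrix true)).trace) := by
    ext x
    let N : MvPolynomial (Bool × ι × ι) ℂ :=
      (genericMatrix true * genericMatrix false : Matrix ι ι _).trace
    have h1 : HasDerivAt (fun s : ℝ => F (s, x)) (fderiv ℝ F (0, x) ((1 : ℝ), 0)) 0 :=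
      (F.differentiableAt (x := (0, x))).hasFDerivAt.comp_hasDerivAt 0
        ((hasDerivAt_id (0 : ℝ)).prodMk (hasDerivAt_const (0 : ℝ) x))
    have h2 := hexp.mul ((hasDerivAt_evalConjTranspose A x P).mul
      (hasDerivAt_evalConjTranspose A x N).fun_neg.cexp)
    have e : (fun s : ℝ => F (s, x)) = fun s : ℝ => Complex.exp (-((s ^ 2 : ℝ) : ℂ)) *
        (evalConjTranspose ((1 + s • A) * x * (1 - s • A)) P *
          Complex.exp (-evalConjTranspose ((1 + s • A) * x * (1 - s • A)) N)) := by
      funext s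
      rw [hF, polyGaussian_apply, ← evalConjTranspose_trace_mul]
    rw [e] at h1
    rw [hR, lineDerivOp_apply_eq_fderiv]
    refine (h1.unique h2).trans ?_
    rw [_root_.sub_apply, polyGaussian_apply, polyGaussian_apply, ← evalConjTranspose_trace_mul,
      commutatorDerivation_trace_mul, map_mul, sub_neg_eq_add]
    simp [N]
    ring
  rw [polyGaussianFunctional_apply, polyGaussianFunctional_apply, ← sub_eq_zero, ← map_sub,
    ← hslice, hzero]

end SchwartzMap

namespace SchwartzMap

open MvPolynomial

variable {ι : Type} [Fintype ι]

/-- The real and imaginary parts of the entries as Euclidean coordinates on complex matrices. -/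
noncomputable def matrixReIm (ι : Type) [Fintype ι] :
    Matrix ι ι ℂ ≃L[ℝ] EuclideanSpace ℝ (Bool × ι × ι) :=
  LinearEquiv.toContinuousLinearEquiv
    { toFun := fun x => WithLp.toLp 2 fun p =>
        if p.1 then (x p.2.1 p.2.2).re else (x p.2.1 p.2.2).im
      invFun := fun y => Matrix.of fun i j => ⟨y (true, i, j), y (false, i, j)⟩
      left_inv := fun x => rfl
      right_inv := fun y => by
        ext ⟨b, i, j⟩
        cases b <;> rfl
      map_add' := fun x y => by
        ext ⟨b, i, j⟩
        cases b <;> simp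
      map_smul' := fun c x => by
        ext ⟨b, i, j⟩
        cases b <;> simp }

theorem matrixReIm_apply (x : Matrix ι ι ℂ) (p : Bool × ι × ι) :
    matrixReIm ι x p = if p.1 then (x p.2.1 p.2.2).re else (x p.2.1 p.2.2).im := rfl

theorem norm_sq_matrixReIm (x : Matrix ι ι ℂ) :
    ‖matrixReIm ι x‖ ^ 2 = ∑ i, ∑ j, ‖x i j‖ ^ 2 := by
  rw [EuclideanSpace.norm_sq_eq, Fintype.sum_prod_type, Fintype.sum_bool, ← Finset.sum_add_distrib,
    Fintype.sum_prod_type]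
  refine Finset.sum_congr rfl fun i _ => Finset.sum_congr rfl fun j _ => ?_
  rw [Complex.sq_norm, Complex.normSq_apply]
  simp [matrixReIm_apply, pow_two]

/-- A polynomial in `x` and `xᴴ` which evaluates to the real or imaginary part of an entry. -/
noncomputable def reImPolynomial (p : Bool × ι × ι) : MvPolynomial (Bool × ι × ι) ℂ :=
  if p.1 then C (1 / 2) * (X (true, p.2.1, p.2.2) + X (false, p.2.2, p.2.1))
  else C (1 / (2 * Complex.I)) * (X (true, p.2.1, p.2.2) - X (false, p.2.2, p.2.1))

theorem evalConjTranspose_reImPolynomial (x : Matrix ι ι ℂ) (p : Bool × ι × ι) :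
    evalConjTranspose x (reImPolynomial p) = (matrixReIm ι x p : ℂ) := by
  obtain ⟨b, i, j⟩ := p
  cases b
  · simp [reImPolynomial, evalConjTranspose_X, matrixReIm_apply,
      Complex.im_eq_sub_conj, -one_div]
    ring
  · simp [reImPolynomial, evalConjTranspose_X, matrixReIm_apply,
      Complex.re_eq_add_conj, -one_div]
    ring

theorem eq_zero_of_polyGaussianFunctional_eq_zero {T : 𝓢(Matrix ι ι ℂ, ℂ) →L[ℂ] ℂ}
    (hT : polyGaussianFunctional T = 0) : T = 0 := by
  have h : T ∘L compCLMOfContinuousLinearEquiv ℂ (matrixReIm ι) = 0 := by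
    refine eq_zero_of_forall_monomial_mul_gaussian fun k p φ hφ => ?_
    have e : compCLMOfContinuousLinearEquiv ℂ (matrixReIm ι) φ =
        polyGaussian (∏ j, reImPolynomial (p j)) := by
      ext x
      change φ (matrixReIm ι x) = _
      rw [hφ, gaussian_apply,
        norm_sq_matrixReIm, polyGaussian_apply, map_prod]
      simp only [evalConjTranspose_reImPolynomial]
    rw [ContinuousLinearMap.comp_apply, e, ← polyGaussianFunctional_apply, hT, LinearMap.zero_apply]
  ext φ
  have e : φ = compCLMOfContinuousLinearEquiv ℂ (matrixReIm ι)
      (compCLMOfContinuousLinearEquiv ℂ (matrixReIm ι).symm φ) := by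
    ext x
    exact congrArg φ ((matrixReIm ι).symm_apply_apply x).symm
  rw [e]
  exact DFunLike.congr_fun h _

/-- Transposition as a continuous linear automorphism of the space of complex matrices. -/
noncomputable def transposeEquiv (ι : Type) [Fintype ι] : Matrix ι ι ℂ ≃L[ℝ] Matrix ι ι ℂ :=
  (Matrix.transposeLinearEquiv ι ι ℝ ℂ).toContinuousLinearEquiv

theorem comp_transpose_eq_of_conjInvariant [DecidableEq ι] {T : 𝓢(Matrix ι ι ℂ, ℂ) →L[ℂ] ℂ}
    (hT : ∀ (g : (Matrix ι ι ℂ)ˣ) (φ ψ : 𝓢(Matrix ι ι ℂ, ℂ)),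
      (∀ x, ψ x = φ ((g : Matrix ι ι ℂ) * x * (↑g⁻¹ : Matrix ι ι ℂ))) → T ψ = T φ) :
    T ∘L compCLMOfContinuousLinearEquiv ℂ (transposeEquiv ι) = T := by
  let τ : 𝓢(Matrix ι ι ℂ, ℂ) →L[ℂ] 𝓢(Matrix ι ι ℂ, ℂ) :=
    compCLMOfContinuousLinearEquiv ℂ (transposeEquiv ι)
  have hτ : ∀ φ x, τ φ x = φ xᵀ := fun φ x => rfl
  have hinv : ∀ (g : (Matrix ι ι ℂ)ˣ) (φ ψ : 𝓢(Matrix ι ι ℂ, ℂ)),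
      (∀ x, ψ x = φ ((g : Matrix ι ι ℂ) * x * (↑g⁻¹ : Matrix ι ι ℂ))) →
      (T - T ∘L τ) ψ = (T - T ∘L τ) φ := by
    intro g φ ψ h
    let g' : (Matrix ι ι ℂ)ˣ := ⟨(↑g⁻¹ : Matrix ι ι ℂ)ᵀ, (g : Matrix ι ι ℂ)ᵀ,
      by rw [← transpose_mul, Units.mul_inv, transpose_one],
      by rw [← transpose_mul, Units.inv_mul, transpose_one]⟩
    have h1 := hT g' (τ φ) (τ ψ) fun x => by
      rw [hτ, hτ, h]
      simp only [transpose_mul, g', Units.inv_mk, mul_assoc, transpose_transpose]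
    simp only [_root_.sub_apply, ContinuousLinearMap.comp_apply, h1, hT g φ ψ h]
  have hodd : ∀ P, polyGaussianFunctional (T - T ∘L τ) (transposeVars P) =
      -polyGaussianFunctional (T - T ∘L τ) P := by
    intro P
    have e1 : τ (polyGaussian P) = polyGaussian (transposeVars P) := by
      ext x
      rw [hτ, polyGaussian_apply, polyGaussian_apply, evalConjTranspose_transposeVars,
        Finset.sum_comm]
      rfl
    have e2 : τ (polyGaussian (transposeVars P)) = polyGaussian P := by
      rw [← e1]
      ext x
      rw [hτ, hτ, transpose_transpose]
    simp only [polyGaussianFunctional_apply, _root_.sub_apply, ContinuousLinearMap.comp_apply, e1,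
      e2]
    ring
  have hzero : T - T ∘L τ = 0 := eq_zero_of_polyGaussianFunctional_eq_zero
    ((isConjInvariant_of_sq_zero fun A hA P =>
      polyGaussianFunctional_commutatorDerivation hinv A hA P).eq_zero hodd)
  exact (sub_eq_zero.1 hzero).symm

end SchwartzMap

theorem conjugation_invariant_tempered_distribution_transpose_invariant_complex
    (n : ℕ) (hn : 0 < n)
    (T : 𝓢(Matrix (Fin n) (Fin n) ℂ, ℂ) →L[ℂ] ℂ)
    (hconj : ∀ (g : (Matrix (Fin n) (Fin n) ℂ)ˣ)
      (φ ψ : 𝓢(Matrix (Fin n) (Fin n) ℂ, ℂ)),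
      (∀ x : Matrix (Fin n) (Fin n) ℂ,
        ψ x = φ ((g : Matrix (Fin n) (Fin n) ℂ) * x *
          (↑g⁻¹ : Matrix (Fin n) (Fin n) ℂ))) → T ψ = T φ) :
    ∀ (φ ψ : 𝓢(Matrix (Fin n) (Fin n) ℂ, ℂ)),
      (∀ x : Matrix (Fin n) (Fin n) ℂ, ψ x = φ xᵀ) → T ψ = T φ := by
  intro φ ψ h
  have e : ψ = compCLMOfContinuousLinearEquiv ℂ (transposeEquiv (Fin n)) φ := SchwartzMap.ext h
  rw [e]
  exact DFunLike.congr_fun (comp_transpose_eq_of_conjInvariant hconj) φ
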